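/- arXiv:1812.04508 — 11 statements merged into one kernel-verified Lean document; each statement's English description precedes it below -/
import Mathlib

section
/- Let G be a fan loop. Then for all a, b, c in G the following identities hold (all inverses are taken in the subgroup N(G)): (1) b\e = t(e/b, b, b\e)·(e/b); (2) b\e = (e/b)·p(e/b, b, b\e); (3) (a\e)·b = t(e/a, a, a\e)·[t(e/a, a, a\b)]⁻¹·(a\b) and a\b = ((a\e)·b)·p(a, a\e, b); (4) (bc)\a = (c\(b\a))·[p(b, c, (bc)\a)]⁻¹; (5) (a\b)·c = (a\(bc))·[p(a, a\b, c)]⁻¹; (6) (ab)\e = ((b\e)·(a\e))·[t(a, b, b\e)]⁻¹·t(ab, b\e, a\e). -/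
/-- The nucleus of a magma: elements associating with all pairs in all three positions. -/
def nucleus (G : Type*) [Mul G] : Set G :=
  {a | (∀ b c : G, (a * b) * c = a * (b * c)) ∧ (∀ b c : G, (b * a) * c = b * (a * c)) ∧
       (∀ b c : G, (b * c) * a = b * (c * a))}

/-- The center of a magma: commuting elements of the nucleus. -/
def centrum (G : Type*) [Mul G] : Set G :=
  {a | ∀ b : G, a * b = b * a} ∩ nucleus G

/-- A (nonassociative) fan loop. -/
class FanLoop (G : Type*) extends Mul G, One G where
  /-- left division: `ldiv a b` is the unique `x` with `a * x = b`. -/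
  ldiv : G → G → G
  /-- right division: `rdiv b a` is the unique `y` with `y * a = b`. -/
  rdiv : G → G → G
  one_mul : ∀ a : G, 1 * a = a
  mul_one : ∀ a : G, a * 1 = a
  mul_ldiv : ∀ a b : G, a * ldiv a b = b
  ldiv_unique : ∀ a x b : G, a * x = b → x = ldiv a b
  rdiv_mul : ∀ a b : G, rdiv b a * a = b
  rdiv_unique : ∀ a y b : G, y * a = b → y = rdiv b a
  t : G → G → G → G
  p : G → G → G → G
  t_mem : ∀ a b c : G, t a b c ∈ nucleus G
  p_mem : ∀ a b c : G, p a b c ∈ nucleus G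
  t_spec : ∀ a b c : G, (a * b) * c = t a b c * (a * (b * c))
  p_spec : ∀ a b c : G, (a * b) * c = (a * (b * c)) * p a b c

namespace FanLoop
variable {G : Type*} [FanLoop G]
/-- the inverse `x⁻¹ = x \ e` of an element (used for elements of the nucleus,
where it is the two-sided group inverse). -/
def linv (x : G) : G := ldiv x 1
end FanLoop

open FanLoop

theorem fl_lcancel {G : Type*} [FanLoop G] {a x y : G} (h : a * x = a * y) : x = y :=
  (ldiv_unique a x _ h).trans (ldiv_unique a y _ rfl).symm

theorem fl_rcancel {G : Type*} [FanLoop G] {a x y : G} (h : x * a = y * a) : x = y :=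
  (rdiv_unique a x _ h).trans (rdiv_unique a y _ rfl).symm

theorem fl_mul_linv {G : Type*} [FanLoop G] (n : G) : n * linv n = 1 := mul_ldiv n 1

theorem fl_linv_mul {G : Type*} [FanLoop G] {n : G} (hn : n ∈ nucleus G) : linv n * n = 1 := by
  apply fl_lcancel (a := n)
  rw [← hn.1, fl_mul_linv, FanLoop.one_mul, FanLoop.mul_one]

theorem fl_linv_mem {G : Type*} [FanLoop G] {n : G} (hn : n ∈ nucleus G) :
    linv n ∈ nucleus G := by
  have h1 := fl_mul_linv n
  have h2 := fl_linv_mul hn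
  obtain ⟨l, m, r⟩ := hn
  have hl : ∀ x : G, n * (linv n * x) = x := fun x => by rw [← l, h1, FanLoop.one_mul]
  have hr : ∀ x : G, (x * linv n) * n = x := fun x => by rw [r, h2, FanLoop.mul_one]
  refine ⟨fun b c => ?_, fun b c => ?_, fun b c => ?_⟩
  · apply fl_lcancel (a := n)
    rw [hl, ← l, hl]
  · have := m (b * linv n) (linv n * c)
    rw [hr, hl] at this
    exact this.symm
  · apply fl_rcancel (a := n)
    rw [hr, r, hr]

/-- Right division by a nucleus element. -/
theorem fl_eq_mul_linv {G : Type*} [FanLoop G] {n x y : G} (hn : n ∈ nucleus G)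
    (h : x * n = y) : x = y * linv n := by
  rw [← h, hn.2.1, fl_mul_linv, FanLoop.mul_one]

/-- Left division by a nucleus element. -/
theorem fl_eq_linv_mul {G : Type*} [FanLoop G] {n x y : G} (hn : n ∈ nucleus G)
    (h : n * x = y) : x = linv n * y := by
  rw [← h, ← hn.2.1, fl_linv_mul hn, FanLoop.one_mul]

/-- Lemma 2.2 of Ludkowski, "Left invariant measures on locally compact fan loops". -/
theorem fanLoop_ldiv_identities {G : Type*} [FanLoop G] (a b c : G) :
    ldiv b 1 = t (rdiv 1 b) b (ldiv b 1) * rdiv 1 b ∧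
    ldiv b 1 = rdiv 1 b * p (rdiv 1 b) b (ldiv b 1) ∧
    ldiv a 1 * b = t (rdiv 1 a) a (ldiv a 1) * linv (t (rdiv 1 a) a (ldiv a b)) * ldiv a b ∧
    ldiv a b = ldiv a 1 * b * p a (ldiv a 1) b ∧
    ldiv (b * c) a = ldiv c (ldiv b a) * linv (p b c (ldiv (b * c) a)) ∧
    ldiv a b * c = ldiv a (b * c) * linv (p a (ldiv a b) c) ∧
    ldiv (a * b) 1 =
      ldiv b 1 * ldiv a 1 * linv (t a b (ldiv b 1)) * t (a * b) (ldiv b 1) (ldiv a 1) := by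
  have e1 : ∀ b : G, ldiv b 1 = t (rdiv 1 b) b (ldiv b 1) * rdiv 1 b := fun b => by
    have := t_spec (rdiv 1 b) b (ldiv b 1)
    rwa [rdiv_mul, FanLoop.one_mul, mul_ldiv, FanLoop.mul_one] at this
  refine ⟨e1 b, ?_, ?_, ?_, ?_, ?_, ?_⟩
  · have := p_spec (rdiv 1 b) b (ldiv b 1)
    rwa [rdiv_mul, FanLoop.one_mul, mul_ldiv, FanLoop.mul_one] at this
  · have h := t_spec (rdiv 1 a) a (ldiv a b)
    rw [rdiv_mul, FanLoop.one_mul, mul_ldiv] at h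
    have h' := fl_eq_linv_mul (t_mem _ _ _) h.symm
    have h3 : ldiv a 1 * b = t (rdiv 1 a) a (ldiv a 1) * rdiv 1 a * b := congrArg (· * b) (e1 a)
    rw [h3, (t_mem _ _ _).1, (t_mem _ _ _).1, ← h']
  · have h := p_spec a (ldiv a 1) b
    rw [mul_ldiv, FanLoop.one_mul, (p_mem _ _ _).2.2] at h
    exact (ldiv_unique _ _ _ h.symm).symm
  · apply fl_eq_mul_linv (p_mem _ _ _)
    apply ldiv_unique
    apply ldiv_unique
    rw [← (p_mem _ _ _).2.2, ← (p_mem _ _ _).2.2, ← p_spec, mul_ldiv]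
  · apply fl_eq_mul_linv (p_mem _ _ _)
    apply ldiv_unique
    rw [← (p_mem _ _ _).2.2, ← p_spec, mul_ldiv]
  · symm
    apply ldiv_unique
    have h := t_spec (a * b) (ldiv b 1) (ldiv a 1)
    have h0 := t_spec a b (ldiv b 1)
    rw [mul_ldiv, FanLoop.mul_one] at h0
    rw [h0, (t_mem _ _ _).1, mul_ldiv, FanLoop.mul_one] at h
    have hT := t_mem (a * b) (ldiv b 1) (ldiv a 1)
    have ht := t_mem a b (ldiv b 1)
    have h' := fl_eq_linv_mul hT h.symm
    rw [← hT.2.2, ← (fl_linv_mem ht).2.2, h', ht.2.1, fl_mul_linv, FanLoop.mul_one,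
      fl_linv_mul hT]
end

section
/- Let G be a fan loop. Then for all a, b, c in G the following identities hold (all inverses are taken in the subgroup N(G)): (1) b·(e/a) = (b/a)·p(b/a, a, a\e)·[p(e/a, a, a\e)]⁻¹ and b/a = [t(b, e/a, a)]⁻¹·(b·(e/a)); (2) a/(bc) = t(a/(bc), b, c)·((a/c)/b); (3) c·(b/a) = t(c, b/a, a)·((cb)/a); (4) e/(ab) = [p(e/b, e/a, ab)]⁻¹·p(e/a, a, b)·((e/b)·(e/a)). -/
open FanLoop

namespace FanLoop
variable {G : Type*} [FanLoop G]

theorem my_lc {a x y : G} (h : a * x = a * y) : x = y :=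
  (ldiv_unique a x _ h).trans (ldiv_unique a y _ rfl).symm

theorem my_rc {a x y : G} (h : x * a = y * a) : x = y :=
  (rdiv_unique a x _ h).trans (rdiv_unique a y _ rfl).symm

theorem my_mul_linv (n : G) : n * linv n = 1 := mul_ldiv n 1

theorem my_linv_mul {n : G} (hn : n ∈ nucleus G) : linv n * n = 1 := by
  apply my_lc (a := n)
  rw [← hn.1, my_mul_linv, FanLoop.one_mul, FanLoop.mul_one]

/-- left cancellation of a nuclear element against its inverse -/
theorem my_cancel1 {n : G} (hn : n ∈ nucleus G) (x : G) : n * (linv n * x) = x := by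
  rw [← hn.1, my_mul_linv, FanLoop.one_mul]

theorem my_cancel2 {n : G} (hn : n ∈ nucleus G) (x : G) : linv n * (n * x) = x := by
  rw [← hn.2.1, my_linv_mul hn, FanLoop.one_mul]

theorem my_cancel3 {n : G} (hn : n ∈ nucleus G) (x : G) : (x * linv n) * n = x := by
  rw [hn.2.2, my_linv_mul hn, FanLoop.mul_one]

theorem my_linv_left {n : G} (hn : n ∈ nucleus G) (x y : G) :
    (linv n * x) * y = linv n * (x * y) := by
  apply my_lc (a := n)
  rw [← hn.1, my_cancel1 hn, my_cancel1 hn]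

theorem my_linv_right {n : G} (hn : n ∈ nucleus G) (x y : G) :
    (x * y) * linv n = x * (y * linv n) := by
  apply my_rc (a := n)
  rw [my_cancel3 hn, hn.2.2, my_cancel3 hn]

end FanLoop

/-- Lemma 2.2 (right-division identities) of Ludkowski,
"Left invariant measures on locally compact fan loops". -/
theorem fanLoop_rdiv_identities {G : Type*} [FanLoop G] (a b c : G) :
    b * rdiv 1 a = rdiv b a * p (rdiv b a) a (ldiv a 1) * linv (p (rdiv 1 a) a (ldiv a 1)) ∧
    rdiv b a = linv (t b (rdiv 1 a) a) * (b * rdiv 1 a) ∧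
    rdiv a (b * c) = t (rdiv a (b * c)) b c * rdiv (rdiv a c) b ∧
    c * rdiv b a = t c (rdiv b a) a * rdiv (c * b) a ∧
    rdiv 1 (a * b) =
      linv (p (rdiv 1 b) (rdiv 1 a) (a * b)) * p (rdiv 1 a) a b * (rdiv 1 b * rdiv 1 a) := by
  refine ⟨?_, ?_, ?_, ?_, ?_⟩
  · have hp := p_mem (rdiv 1 a) a (ldiv a 1)
    have h1 := p_spec (rdiv 1 a) a (ldiv a 1)
    have h2 := p_spec (rdiv b a) a (ldiv a 1)
    rw [rdiv_mul, mul_ldiv, FanLoop.mul_one] at h2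
    rw [rdiv_mul, mul_ldiv, FanLoop.mul_one, FanLoop.one_mul] at h1
    rw [← h2]
    apply my_rc (a := p (rdiv 1 a) a (ldiv a 1))
    rw [my_cancel3 hp, hp.2.2, ← h1]
  · have ht := t_mem b (rdiv 1 a) a
    symm
    apply rdiv_unique
    rw [my_linv_left ht, t_spec b, rdiv_mul, FanLoop.mul_one, my_cancel2 ht]
  · have ht := t_mem (rdiv a (b * c)) b c
    have h := t_spec (rdiv a (b * c)) b c
    rw [rdiv_mul] at h
    apply my_rc (a := b)
    apply my_rc (a := c)
    rw [h, ht.1, rdiv_mul, ht.1, rdiv_mul]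
  · have ht := t_mem c (rdiv b a) a
    apply my_rc (a := a)
    rw [t_spec c, rdiv_mul, ht.1, rdiv_mul]
  · have hp := p_mem (rdiv 1 a) a b
    have hq := p_mem (rdiv 1 b) (rdiv 1 a) (a * b)
    have h1 := p_spec (rdiv 1 a) a b
    have h2 := p_spec (rdiv 1 b) (rdiv 1 a) (a * b)
    rw [rdiv_mul, FanLoop.one_mul] at h1
    have h3 : p (rdiv 1 a) a b * (rdiv 1 b * (rdiv 1 a * (a * b))) = 1 := by
      have h4 : (rdiv 1 b * (rdiv 1 a * (a * b))) * p (rdiv 1 a) a b = 1 := by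
        rw [hp.2.2, ← h1, rdiv_mul]
      have h5 : rdiv 1 b * (rdiv 1 a * (a * b)) = linv (p (rdiv 1 a) a b) := by
        apply my_rc (a := p (rdiv 1 a) a b)
        rw [h4, my_linv_mul hp]
      rw [h5, my_mul_linv]
    symm
    apply rdiv_unique
    rw [my_linv_left hq, my_linv_left hq, hp.1, h2, ← hp.1, h3, FanLoop.one_mul,
      my_linv_mul hq]
end

section
/- Let G be a fan loop. Then for every a₁, a₂, a₃ in G and b in the nucleus N(G): (1) t(a₁, a₂, a₃b) = t(a₁, a₂, a₃); (2) p(ba₁, a₂, a₃) = p(a₁, a₂, a₃); (3) t(ba₁, a₂, a₃) = b·t(a₁, a₂, a₃)·b⁻¹; (4) p(a₁, a₂, a₃b) = b⁻¹·p(a₁, a₂, a₃)·b, where inverses are taken in the subgroup N(G). -/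
open FanLoop

/-- Lemma 2.3 (nucleus identities) of Ludkowski,
"Left invariant measures on locally compact fan loops". -/
theorem fanLoop_nucleus_identities {G : Type*} [FanLoop G] (a₁ a₂ a₃ b : G)
    (hb : b ∈ nucleus G) :
    t a₁ a₂ (a₃ * b) = t a₁ a₂ a₃ ∧
    p (b * a₁) a₂ a₃ = p a₁ a₂ a₃ ∧
    t (b * a₁) a₂ a₃ = b * t a₁ a₂ a₃ * linv b ∧
    p a₁ a₂ (a₃ * b) = linv b * p a₁ a₂ a₃ * b := by
  obtain ⟨h1, h2, h3⟩ := hb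
  have lc : ∀ a x y : G, a * x = a * y → x = y := fun a x y h =>
    (ldiv_unique a x _ h).trans (ldiv_unique a y _ rfl).symm
  have rc : ∀ a x y : G, x * a = y * a → x = y := fun a x y h =>
    (rdiv_unique a x _ h).trans (rdiv_unique a y _ rfl).symm
  have e1 : b * linv b = 1 := mul_ldiv b 1
  have e2 : linv b * b = 1 := by
    apply lc b
    rw [← h1, e1, FanLoop.one_mul, FanLoop.mul_one]
  refine ⟨?_, ?_, ?_, ?_⟩
  · apply rc (a₁ * (a₂ * (a₃ * b)))
    rw [← t_spec, ← h3, t_spec a₁ a₂ a₃, ← h3 a₂, ← h3 a₁, h3]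
  · apply lc ((b * a₁) * (a₂ * a₃))
    rw [← p_spec, h1, h1, p_spec, h1, h1]
  · apply rc ((b * a₁) * (a₂ * a₃))
    rw [← t_spec, h1, h1, t_spec, h1 a₁ (a₂ * a₃), ← h2 (b * t a₁ a₂ a₃ * linv b), h3, e2,
      FanLoop.mul_one, h1]
  · apply lc (a₁ * (a₂ * (a₃ * b)))
    rw [← p_spec, ← h3, p_spec a₁ a₂ a₃, ← h3 a₂, ← h3 a₁, h2, ← h1 (linv b * p a₁ a₂ a₃), ← h1 (linv b),
      e1, FanLoop.one_mul, h3]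
end

section
/- Let G be a T1 topological fan loop with structure functions t, p : G×G×G → N(G). Then for each compact subset S of G and each open neighborhood V of e there exists an open neighborhood U of e in G such that t((u₁a)v₁, (u₂b)v₂, (u₃c)v₃) ∈ (V·t(a,b,c)) ∩ (t(a,b,c)·V) and p((u₁a)v₁, (u₂b)v₂, (u₃c)v₃) ∈ (V·p(a,b,c)) ∩ (p(a,b,c)·V) for all a, b, c ∈ S and all u₁, u₂, u₃, v₁, v₂, v₃ ∈ Ǔ, where Ǔ = U ∪ {a\e : a ∈ U} ∪ {e/a : a ∈ U}. -/
open FanLoop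

/-- The symmetrization Ǔ of a subset of a fan loop. -/
def checkSet {G : Type*} [FanLoop G] (U : Set G) : Set G :=
  U ∪ (fun a : G => ldiv a 1) '' U ∪ (fun a : G => rdiv 1 a) '' U

/-- Proposition 2.9 of Ludkowski: uniform approximate invariance of the structure
functions t and p on compact sets under small perturbations of their arguments. -/
theorem fanLoop_tp_uniform_perturbation {G : Type*} [TopologicalSpace G] [T1Space G]
    [FanLoop G]
    (hm : Continuous fun q : G × G => q.1 * q.2)
    (hl : Continuous fun q : G × G => ldiv q.1 q.2)
    (hr : Continuous fun q : G × G => rdiv q.1 q.2)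
    (S : Set G) (hS : IsCompact S) (V : Set G) (hV : IsOpen V) (h1V : (1 : G) ∈ V) :
    ∃ U : Set G, IsOpen U ∧ (1 : G) ∈ U ∧
      ∀ a ∈ S, ∀ b ∈ S, ∀ c ∈ S,
      ∀ u₁ ∈ checkSet U, ∀ u₂ ∈ checkSet U, ∀ u₃ ∈ checkSet U,
      ∀ v₁ ∈ checkSet U, ∀ v₂ ∈ checkSet U, ∀ v₃ ∈ checkSet U,
        t ((u₁ * a) * v₁) ((u₂ * b) * v₂) ((u₃ * c) * v₃) ∈
          ((· * t a b c) '' V) ∩ ((t a b c * ·) '' V) ∧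
        p ((u₁ * a) * v₁) ((u₂ * b) * v₂) ((u₃ * c) * v₃) ∈
          ((· * p a b c) '' V) ∩ ((p a b c * ·) '' V) := by
  have mul' : ∀ {X : Type _} [TopologicalSpace X] {f g : X → G}, Continuous f → Continuous g →
      Continuous fun x => f x * g x := fun hf hg => hm.comp (hf.prodMk hg)
  have l' : ∀ {X : Type _} [TopologicalSpace X] {f g : X → G}, Continuous f → Continuous g →
      Continuous fun x => ldiv (f x) (g x) := fun hf hg => hl.comp (hf.prodMk hg)
  have r' : ∀ {X : Type _} [TopologicalSpace X] {f g : X → G}, Continuous f → Continuous g →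
      Continuous fun x => rdiv (f x) (g x) := fun hf hg => hr.comp (hf.prodMk hg)
  have ht : ∀ {X : Type _} [TopologicalSpace X] {f g h : X → G}, Continuous f → Continuous g →
      Continuous h → Continuous fun x => t (f x) (g x) (h x) := by
    intro X _ f g h hf hg hh
    have : (fun x => t (f x) (g x) (h x)) =
        fun x => rdiv ((f x * g x) * h x) (f x * (g x * h x)) := by
      funext x
      exact rdiv_unique _ _ _ (t_spec _ _ _).symm
    rw [this]
    exact r' (mul' (mul' hf hg) hh) (mul' hf (mul' hg hh))
  have hp : ∀ {X : Type _} [TopologicalSpace X] {f g h : X → G}, Continuous f → Continuous g →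
      Continuous h → Continuous fun x => p (f x) (g x) (h x) := by
    intro X _ f g h hf hg hh
    have : (fun x => p (f x) (g x) (h x)) =
        fun x => ldiv (f x * (g x * h x)) ((f x * g x) * h x) := by
      funext x
      exact ldiv_unique _ _ _ (p_spec _ _ _).symm
    rw [this]
    exact l' (mul' hf (mul' hg hh)) (mul' (mul' hf hg) hh)
  have rself : ∀ a : G, rdiv a a = 1 := fun a => (rdiv_unique _ _ _ (FanLoop.one_mul a)).symm
  have lself : ∀ a : G, ldiv a a = 1 := fun a => (ldiv_unique _ _ _ (FanLoop.mul_one a)).symm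
  let A : (G × G × G) × (Fin 6 → G) → G := fun z => (z.2 0 * z.1.1) * z.2 3
  let B : (G × G × G) × (Fin 6 → G) → G := fun z => (z.2 1 * z.1.2.1) * z.2 4
  let C : (G × G × G) × (Fin 6 → G) → G := fun z => (z.2 2 * z.1.2.2) * z.2 5
  have hA : Continuous A := mul' (mul' (by fun_prop) (by fun_prop)) (by fun_prop)
  have hB : Continuous B := mul' (mul' (by fun_prop) (by fun_prop)) (by fun_prop)
  have hC : Continuous C := mul' (mul' (by fun_prop) (by fun_prop)) (by fun_prop)
  have hT : Continuous fun z => t (A z) (B z) (C z) := ht hA hB hC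
  have hP : Continuous fun z => p (A z) (B z) (C z) := hp hA hB hC
  have hT0 : Continuous fun z : (G × G × G) × (Fin 6 → G) => t z.1.1 z.1.2.1 z.1.2.2 :=
    ht (by fun_prop) (by fun_prop) (by fun_prop)
  have hP0 : Continuous fun z : (G × G × G) × (Fin 6 → G) => p z.1.1 z.1.2.1 z.1.2.2 :=
    hp (by fun_prop) (by fun_prop) (by fun_prop)
  let W : Set ((G × G × G) × (Fin 6 → G)) :=
    (((fun z => rdiv (t (A z) (B z) (C z)) (t z.1.1 z.1.2.1 z.1.2.2)) ⁻¹' V) ∩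
     ((fun z => ldiv (t z.1.1 z.1.2.1 z.1.2.2) (t (A z) (B z) (C z))) ⁻¹' V)) ∩
    (((fun z => rdiv (p (A z) (B z) (C z)) (p z.1.1 z.1.2.1 z.1.2.2)) ⁻¹' V) ∩
     ((fun z => ldiv (p z.1.1 z.1.2.1 z.1.2.2) (p (A z) (B z) (C z))) ⁻¹' V))
  have hW : IsOpen W :=
    ((hV.preimage (r' hT hT0)).inter (hV.preimage (l' hT0 hT))).inter
      ((hV.preimage (r' hP hP0)).inter (hV.preimage (l' hP0 hP)))
  have hsub : (S ×ˢ S ×ˢ S) ×ˢ ({fun _ => 1} : Set (Fin 6 → G)) ⊆ W := by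
    rintro ⟨⟨a, b, c⟩, w⟩ ⟨-, hw⟩
    obtain rfl : w = fun _ => 1 := hw
    simp [W, A, B, C, FanLoop.one_mul, FanLoop.mul_one, rself, lself, h1V]
  obtain ⟨K, M, -, hMo, hK, hM, hKM⟩ :=
    generalized_tube_lemma (hS.prod (hS.prod hS)) isCompact_singleton hW hsub
  have h1M : (fun _ => 1 : Fin 6 → G) ∈ M := hM rfl
  obtain ⟨u, hu, huM⟩ := isOpen_pi_iff'.1 hMo _ h1M
  let U0 : Set G := ⋂ i, u i
  have hU0 : IsOpen U0 := isOpen_iInter_of_finite fun i => (hu i).1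
  have h1U0 : (1 : G) ∈ U0 := Set.mem_iInter.2 fun i => (hu i).2
  let U : Set G := U0 ∩ ((fun a => ldiv a 1) ⁻¹' U0 ∩ (fun a => rdiv 1 a) ⁻¹' U0)
  have hUU : checkSet U ⊆ U0 := by
    rintro x ((hx | ⟨y, hy, rfl⟩) | ⟨y, hy, rfl⟩)
    · exact hx.1
    · exact hy.2.1
    · exact hy.2.2
  refine ⟨U, hU0.inter ((hU0.preimage (l' continuous_id continuous_const)).inter
    (hU0.preimage (r' continuous_const continuous_id))), ⟨h1U0, ?_, ?_⟩, ?_⟩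
  · simpa [lself] using h1U0
  · simpa [rself] using h1U0
  intro a ha b hb c hc u₁ h₁ u₂ h₂ u₃ h₃ v₁ k₁ v₂ k₂ v₃ k₃
  have hmem : (![u₁, u₂, u₃, v₁, v₂, v₃] : Fin 6 → G) ∈ M := by
    apply huM
    intro i _
    have : (![u₁, u₂, u₃, v₁, v₂, v₃] : Fin 6 → G) i ∈ U0 := by
      fin_cases i
      · exact hUU h₁
      · exact hUU h₂
      · exact hUU h₃
      · exact hUU k₁
      · exact hUU k₂
      · exact hUU k₃
    exact Set.mem_iInter.1 this i
  have hfin : ((a, b, c), (![u₁, u₂, u₃, v₁, v₂, v₃] : Fin 6 → G)) ∈ W :=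
    hKM ⟨hK ⟨ha, hb, hc⟩, hmem⟩
  obtain ⟨⟨q1, q2⟩, q3, q4⟩ := hfin
  exact ⟨⟨⟨_, q1, rdiv_mul _ _⟩, ⟨_, q2, mul_ldiv _ _⟩⟩,
    ⟨⟨_, q3, rdiv_mul _ _⟩, ⟨_, q4, mul_ldiv _ _⟩⟩⟩
end

section
/- Let G and H be T1 topological fan loops and let f : G → H be a continuous map such that for each open neighborhood V of the unit e_H in H there exists a compact subset K_V of G with f(G ∖ K_V) ⊆ V. Then f is uniformly continuous in both senses: for each open neighborhood V of e_H there exists an open neighborhood U of e_G such that for all x, y ∈ G, if x\y ∈ U then f(x)\f(y) ∈ V, and for each open neighborhood V of e_H there exists an open neighborhood U of e_G such that for all x, y ∈ G, if y/x ∈ U then f(y)/f(x) ∈ V. -/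
open FanLoop

theorem fan_aux {G H : Type*} [TopologicalSpace G] [TopologicalSpace H] (e : G) (e' : H)
    (D : H × H → H) (hD : Continuous D) (hD1 : ∀ h, D (h, h) = e')
    (a b : G × G → G) (ha : Continuous a) (hb : Continuous b)
    (ha1 : ∀ x, a (x, e) = x) (hb1 : ∀ x, b (x, e) = x)
    (d : G → G → G) (had : ∀ x y, a (x, d x y) = y) (hbd : ∀ x y, b (y, d x y) = x)
    (f : G → H) (hf : Continuous f)
    (hsmall : ∀ V : Set H, IsOpen V → e' ∈ V →
      ∃ K : Set G, IsCompact K ∧ ∀ x : G, x ∉ K → f x ∈ V)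
    (V : Set H) (hV : IsOpen V) (h1 : e' ∈ V) :
    ∃ U : Set G, IsOpen U ∧ e ∈ U ∧ ∀ x y : G, d x y ∈ U → D (f x, f y) ∈ V := by
  have hO : IsOpen (D ⁻¹' V) := hV.preimage hD
  obtain ⟨A, B, hA, hB, hA1, hB1, hAB⟩ := isOpen_prod_iff.1 hO e' e' (by simpa [hD1] using h1)
  obtain ⟨K, hK, hKW⟩ := hsmall (A ∩ B) (hA.inter hB) ⟨hA1, hB1⟩
  have c1 : IsOpen ((fun q : G × G => D (f q.1, f (a q))) ⁻¹' V) := hV.preimage (by fun_prop)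
  have c2 : IsOpen ((fun q : G × G => D (f (b q), f q.1)) ⁻¹' V) := hV.preimage (by fun_prop)
  obtain ⟨P1, U1, -, hU1, hP1, he1, hs1⟩ := generalized_tube_lemma hK (isCompact_singleton (x := e)) c1 (by
    rintro ⟨x, u⟩ ⟨-, hu⟩
    obtain rfl : u = e := hu
    simpa [ha1, hD1] using h1)
  obtain ⟨P2, U2, -, hU2, hP2, he2, hs2⟩ := generalized_tube_lemma hK (isCompact_singleton (x := e)) c2 (by
    rintro ⟨x, u⟩ ⟨-, hu⟩
    obtain rfl : u = e := hu
    simpa [hb1, hD1] using h1)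
  refine ⟨U1 ∩ U2, hU1.inter hU2, ⟨he1 rfl, he2 rfl⟩, fun x y hxy => ?_⟩
  by_cases hx : x ∈ K
  · have := @hs1 (x, d x y) ⟨hP1 hx, hxy.1⟩
    simpa [had] using this
  by_cases hy : y ∈ K
  · have := @hs2 (y, d x y) ⟨hP2 hy, hxy.2⟩
    simpa [hbd] using this
  · exact @hAB (f x, f y) ⟨(hKW x hx).1, (hKW y hy).2⟩

/-- Theorem 2.14 of Ludkowski: a continuous map between T1 topological fan loops that
is small outside compact sets is uniformly continuous with respect to the left (and
right) uniformities. -/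
theorem fanLoop_uniformly_continuous {G H : Type*}
    [TopologicalSpace G] [T1Space G] [FanLoop G]
    [TopologicalSpace H] [T1Space H] [FanLoop H]
    (hmG : Continuous fun q : G × G => q.1 * q.2)
    (hlG : Continuous fun q : G × G => ldiv q.1 q.2)
    (hrG : Continuous fun q : G × G => rdiv q.1 q.2)
    (hmH : Continuous fun q : H × H => q.1 * q.2)
    (hlH : Continuous fun q : H × H => ldiv q.1 q.2)
    (hrH : Continuous fun q : H × H => rdiv q.1 q.2)
    (f : G → H) (hf : Continuous f)
    (hsmall : ∀ V : Set H, IsOpen V → (1 : H) ∈ V →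
      ∃ K : Set G, IsCompact K ∧ ∀ x : G, x ∉ K → f x ∈ V) :
    (∀ V : Set H, IsOpen V → (1 : H) ∈ V →
      ∃ U : Set G, IsOpen U ∧ (1 : G) ∈ U ∧
        ∀ x y : G, ldiv x y ∈ U → ldiv (f x) (f y) ∈ V) ∧
    (∀ V : Set H, IsOpen V → (1 : H) ∈ V →
      ∃ U : Set G, IsOpen U ∧ (1 : G) ∈ U ∧
        ∀ x y : G, rdiv y x ∈ U → rdiv (f y) (f x) ∈ V) := by
  constructor
  · exact fan_aux (1 : G) (1 : H) (fun q => ldiv q.1 q.2) hlH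
      (fun h => (ldiv_unique _ _ _ (FanLoop.mul_one h)).symm)
      (fun q => q.1 * q.2) (fun q => rdiv q.1 q.2) hmG hrG FanLoop.mul_one
      (fun x => (rdiv_unique _ _ _ (FanLoop.mul_one x)).symm) ldiv mul_ldiv
      (fun x y => (rdiv_unique _ _ _ (mul_ldiv x y)).symm) f hf hsmall
  · exact fan_aux (1 : G) (1 : H) (fun q => rdiv q.2 q.1) (hrH.comp continuous_swap)
      (fun h => (rdiv_unique _ _ _ (FanLoop.one_mul h)).symm)
      (fun q => q.2 * q.1) (fun q => ldiv q.2 q.1) (hmG.comp continuous_swap)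
      (hlG.comp continuous_swap) FanLoop.one_mul
      (fun x => (ldiv_unique _ _ _ (FanLoop.one_mul x)).symm) (fun x y => rdiv y x)
      (fun x y => rdiv_mul x y)
      (fun x y => (ldiv_unique _ _ _ (rdiv_mul x y)).symm) f hf hsmall
end

section
/- Let G be a T1 topological locally compact fan loop and let f : G → ℂ be a continuous bounded function vanishing at infinity (for every ε > 0 there is a compact subset S of G with |f(x)| < ε for all x ∈ G ∖ S). Then f is uniformly continuous in both senses: for every ε > 0 there exists an open neighborhood U of e in G such that for all x, y ∈ G with x\y ∈ U one has |f(x) − f(y)| < ε, and for every ε > 0 there exists an open neighborhood U of e such that for all x, y ∈ G with y/x ∈ U one has |f(x) − f(y)| < ε. -/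
open FanLoop

theorem fan_tube {G : Type*} [TopologicalSpace G] (o : G) (g : G × G → G) (hg : Continuous g)
    (h1 : ∀ x, g (x, o) = x) (f : G → ℂ) (hf : Continuous f) (S : Set G) (hS : IsCompact S)
    (ε : ℝ) (hε : 0 < ε) :
    ∃ U : Set G, IsOpen U ∧ o ∈ U ∧ ∀ x ∈ S, ∀ u ∈ U, ‖f x - f (g (x, u))‖ < ε := by
  have ho : IsOpen {q : G × G | ‖f q.1 - f (g q)‖ < ε} :=
    isOpen_lt (((hf.comp continuous_fst).sub (hf.comp hg)).norm) continuous_const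
  obtain ⟨V, U, _, hU, hSV, hoU, hsub⟩ := generalized_tube_lemma hS (isCompact_singleton (x := o)) ho
    (by
      rintro ⟨x, u⟩ ⟨_, hu⟩
      have hu' : u = o := hu
      subst hu'
      simp [h1, hε])
  exact ⟨U, hU, hoU rfl, fun x hx u hu => hsub (Set.mk_mem_prod (hSV hx) hu)⟩

theorem fan_unif {G : Type*} [TopologicalSpace G] (o : G) (g k d : G × G → G) (hg : Continuous g)
    (hk : Continuous k) (h1 : ∀ x, g (x, o) = x) (h2 : ∀ x, k (x, o) = x)
    (hgd : ∀ x y, g (x, d (x, y)) = y) (hkd : ∀ x y, k (y, d (x, y)) = x)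
    (f : G → ℂ) (hf : Continuous f)
    (hvanish : ∀ ε : ℝ, 0 < ε → ∃ S : Set G, IsCompact S ∧ ∀ x : G, x ∉ S → ‖f x‖ < ε)
    (ε : ℝ) (hε : 0 < ε) :
    ∃ U : Set G, IsOpen U ∧ o ∈ U ∧ ∀ x y : G, d (x, y) ∈ U → ‖f x - f y‖ < ε := by
  obtain ⟨S, hS, hfS⟩ := hvanish (ε / 2) (half_pos hε)
  obtain ⟨U, hU, hoU, hU'⟩ := fan_tube o g hg h1 f hf S hS ε hε
  obtain ⟨V, hV, hoV, hV'⟩ := fan_tube o k hk h2 f hf S hS ε hε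
  refine ⟨U ∩ V, hU.inter hV, ⟨hoU, hoV⟩, fun x y hd => ?_⟩
  by_cases hx : x ∈ S
  · simpa only [hgd] using hU' x hx _ hd.1
  by_cases hy : y ∈ S
  · rw [norm_sub_rev]
    simpa only [hkd] using hV' y hy _ hd.2
  have a := hfS x hx
  have b := hfS y hy
  have c := norm_sub_le (f x) (f y)
  linarith

/-- Corollary 2.15 of Ludkowski: a continuous bounded complex-valued function vanishing
at infinity on a T1 locally compact topological fan loop is left and right uniformly
continuous. -/
theorem fanLoop_C0_uniformly_continuous {G : Type*} [TopologicalSpace G] [T1Space G]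
    [LocallyCompactSpace G] [FanLoop G]
    (hm : Continuous fun q : G × G => q.1 * q.2)
    (hl : Continuous fun q : G × G => ldiv q.1 q.2)
    (hr : Continuous fun q : G × G => rdiv q.1 q.2)
    (f : G → ℂ) (hf : Continuous f) (hbd : ∃ M : ℝ, ∀ x : G, ‖f x‖ ≤ M)
    (hvanish : ∀ ε : ℝ, 0 < ε → ∃ S : Set G, IsCompact S ∧ ∀ x : G, x ∉ S → ‖f x‖ < ε) :
    (∀ ε : ℝ, 0 < ε → ∃ U : Set G, IsOpen U ∧ (1 : G) ∈ U ∧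
      ∀ x y : G, ldiv x y ∈ U → ‖f x - f y‖ < ε) ∧
    (∀ ε : ℝ, 0 < ε → ∃ U : Set G, IsOpen U ∧ (1 : G) ∈ U ∧
      ∀ x y : G, rdiv y x ∈ U → ‖f x - f y‖ < ε) := by
  constructor
  · refine fun ε hε => fan_unif 1 (fun q => q.1 * q.2) (fun q => rdiv q.1 q.2)
      (fun q => ldiv q.1 q.2) hm hr (fun x => FanLoop.mul_one x)
      (fun x => (rdiv_unique 1 x x (FanLoop.mul_one x)).symm) (fun x y => mul_ldiv x y)
      (fun x y => (rdiv_unique _ x y (mul_ldiv x y)).symm) f hf hvanish ε hε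
  · refine fun ε hε => fan_unif 1 (fun q => q.2 * q.1) (fun q => ldiv q.2 q.1)
      (fun q => rdiv q.2 q.1) (hm.comp continuous_swap) (hl.comp continuous_swap)
      (fun x => FanLoop.one_mul x)
      (fun x => (ldiv_unique 1 x x (FanLoop.one_mul x)).symm) (fun x y => rdiv_mul x y)
      (fun x y => (ldiv_unique _ x y (rdiv_mul x y)).symm) f hf hvanish ε hε
end

section
/- Let G be a T1 topological locally compact fan loop, and let f and φ be continuous nonnegative real-valued functions on G with compact support, with φ not identically zero. Then there exist a natural number m > 0, elements b₁, …, b_m in G and positive real constants c₁, …, c_m such that f(x) ≤ Σ_{j=1}^m c_j·φ(b_j x) for all x ∈ G. -/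
open FanLoop

/-- Lemma 3.2 of Ludkowski: a nonnegative compactly supported continuous function on a
T1 locally compact topological fan loop is dominated by a finite positive combination of
left translates of any nonzero nonnegative compactly supported continuous function. -/
theorem fanLoop_covering_estimate {G : Type*} [TopologicalSpace G] [T1Space G]
    [LocallyCompactSpace G] [FanLoop G]
    (hm : Continuous fun q : G × G => q.1 * q.2)
    (hl : Continuous fun q : G × G => ldiv q.1 q.2)
    (hr : Continuous fun q : G × G => rdiv q.1 q.2)
    (f φ : G → ℝ)
    (hf : Continuous f) (hfs : HasCompactSupport f) (hf0 : ∀ x : G, 0 ≤ f x)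
    (hφ : Continuous φ) (hφs : HasCompactSupport φ) (hφ0 : ∀ x : G, 0 ≤ φ x)
    (hφne : φ ≠ 0) :
    ∃ m : ℕ, 0 < m ∧ ∃ (b : Fin m → G) (c : Fin m → ℝ),
      (∀ j, 0 < c j) ∧ ∀ x : G, f x ≤ ∑ j, c j * φ (b j * x) := by
  classical
  obtain ⟨y, hy⟩ : ∃ y, φ y ≠ 0 := by
    by_contra h
    push Not at h
    exact hφne (funext h)
  have hy0 : 0 < φ y := lt_of_le_of_ne (hφ0 y) (Ne.symm hy)
  obtain ⟨M, hM⟩ := IsCompact.exists_bound_of_continuousOn hfs hf.continuousOn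
  have hcont : ∀ a : G, Continuous fun x : G => φ (a * x) := fun a =>
    hφ.comp (hm.comp (continuous_const.prodMk continuous_id))
  obtain ⟨s, hs⟩ := IsCompact.elim_finite_subcover hfs
    (fun a : G => {x : G | φ y / 2 < φ (a * x)})
    (fun a => isOpen_lt continuous_const (hcont a))
    (fun x _ => Set.mem_iUnion.2 ⟨rdiv y x, by
      simp only [Set.mem_setOf_eq, FanLoop.rdiv_mul]; linarith⟩)
  let s' := insert (1 : G) s
  have hc : 0 < (|M| + 1) * (2 / φ y) := by positivity
  refine ⟨s'.card, Finset.card_pos.2 ⟨1, Finset.mem_insert_self _ _⟩,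
    fun j => (s'.equivFin.symm j : G), fun _ => (|M| + 1) * (2 / φ y), fun _ => hc, fun x => ?_⟩
  have hnn : ∀ j ∈ (Finset.univ : Finset (Fin s'.card)),
      0 ≤ (|M| + 1) * (2 / φ y) * φ ((s'.equivFin.symm j : G) * x) :=
    fun j _ => mul_nonneg hc.le (hφ0 _)
  by_cases hx : x ∈ tsupport f
  · obtain ⟨a, ha, hax⟩ := Set.mem_iUnion₂.1 (hs hx)
    simp only [Set.mem_setOf_eq] at hax
    have h1 := Finset.single_le_sum hnn
      (Finset.mem_univ (s'.equivFin ⟨a, Finset.mem_insert_of_mem ha⟩))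
    simp only [Equiv.symm_apply_apply] at h1
    refine le_trans ?_ h1
    have h2 : f x ≤ |M| + 1 := by
      have h3 := hM x hx
      have h4 := le_abs_self M
      have h5 := le_abs_self (f x)
      rw [Real.norm_eq_abs] at h3
      linarith
    calc f x ≤ |M| + 1 := h2
      _ = (|M| + 1) * (2 / φ y) * (φ y / 2) := by field_simp
      _ ≤ _ := mul_le_mul_of_nonneg_left hax.le hc.le
  · rw [image_eq_zero_of_notMem_tsupport hx]
    exact Finset.sum_nonneg hnn
end

section
/- Let G be a T1 topological locally compact fan loop satisfying Condition (3.5.2). Then there exists a functional J : C₀₀⁺(G) → ℝ with the following properties: (1) J(f) ≥ 0 for each f ∈ C₀₀⁺(G), and J(f) > 0 whenever f is not identically zero; (2) J(α₁f₁ + … + αₙfₙ) = α₁J(f₁) + … + αₙJ(fₙ) for all f₁, …, fₙ ∈ C₀₀⁺(G) and all α₁ ≥ 0, …, αₙ ≥ 0; (3) J is left invariant: J(f(b·)) = J(f) for each b ∈ G and f ∈ C₀₀⁺(G), where f(b·)(x) = f(bx). -/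
open FanLoop

/-- Membership in C₀₀⁺(G): continuous, compactly supported and nonnegative. -/
def InC00plus {G : Type*} [TopologicalSpace G] (f : G → ℝ) : Prop :=
  Continuous f ∧ HasCompactSupport f ∧ ∀ x : G, 0 ≤ f x

open MeasureTheory in
lemma fl_core {G N Q : Type*} [TopologicalSpace G] [Mul G]
    [TopologicalSpace N] [Group N] [IsTopologicalGroup N] [CompactSpace N]
    [TopologicalSpace Q] [Group Q] [IsTopologicalGroup Q] [LocallyCompactSpace Q]
    (hm : Continuous fun q : G × G => q.1 * q.2)
    (i : N → G) (hi : Continuous i) (π : G → Q) (hπ : IsOpenQuotientMap π)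
    (hπm : ∀ a b, π (a * b) = π a * π b)
    (hfib : ∀ x y, π x = π y → ∃ n, y = x * i n)
    (hfib' : ∀ x n, π (x * i n) = π x)
    (has : ∀ x m n, (x * i m) * i n = x * i (m * n))
    (has' : ∀ b x n, (b * x) * i n = b * (x * i n))
    (h1 : ∀ x, x * i 1 = x) :
    ∃ J : (G → ℝ) → ℝ,
      (∀ f : G → ℝ, InC00plus f → 0 ≤ J f) ∧
      (∀ f : G → ℝ, InC00plus f → f ≠ 0 → 0 < J f) ∧
      (∀ (n : ℕ) (f : Fin n → G → ℝ) (α : Fin n → ℝ),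
        (∀ i, InC00plus (f i)) → (∀ i, 0 ≤ α i) →
        J (fun x => ∑ i, α i * f i x) = ∑ i, α i * J (f i)) ∧
      (∀ (b : G) (f : G → ℝ), InC00plus f → J (fun x => f (b * x)) = J f) := by
  let : MeasurableSpace N := borel N
  have : BorelSpace N := ⟨rfl⟩
  let : MeasurableSpace Q := borel Q
  have : BorelSpace Q := ⟨rfl⟩
  let ν : Measure N := Measure.haar
  let μ : Measure Q := Measure.haar
  let s : Q → G := Function.surjInv hπ.surjective
  have hs : ∀ q, π (s q) = q := Function.surjInv_eq hπ.surjective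
  let F : (G → ℝ) → Q → ℝ := fun f q => ∫ n, f (s q * i n) ∂ν
  have hF : ∀ f x, F f (π x) = ∫ n, f (x * i n) ∂ν := by
    intro f x
    obtain ⟨m, hm⟩ := hfib x (s (π x)) (hs _).symm
    change ∫ n, f (s (π x) * i n) ∂ν = _
    rw [hm]
    simp only [has]
    exact integral_mul_left_eq_self (fun n => f (x * i n)) m
  have hcont1 : ∀ f : G → ℝ, Continuous f → ∀ x, Continuous fun n => f (x * i n) := by
    intro f hf x
    exact hf.comp (hm.comp (continuous_const.prodMk hi))
  have hint1 : ∀ f : G → ℝ, Continuous f → ∀ x, Integrable (fun n => f (x * i n)) ν := by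
    intro f hf x
    exact (hcont1 f hf x).integrable_of_hasCompactSupport (HasCompactSupport.of_compactSpace _)
  have hFc : ∀ f : G → ℝ, Continuous f → Continuous (F f) := by
    intro f hf
    rw [← hπ.continuous_comp_iff]
    have : F f ∘ π = fun x => ∫ n, f (x * i n) ∂ν := funext fun x => hF f x
    rw [this, ← continuousOn_univ]
    refine continuousOn_integral_of_compact_support (k := Set.univ) isCompact_univ ?_ (by simp)
    refine Continuous.continuousOn ?_
    exact hf.comp (hm.comp (continuous_fst.prodMk (hi.comp continuous_snd)))
  have hFs : ∀ f : G → ℝ, HasCompactSupport f → HasCompactSupport (F f) := by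
    intro f hf
    refine HasCompactSupport.intro (hf.isCompact.image hπ.continuous) ?_
    intro q hq
    change ∫ n, f (s q * i n) ∂ν = 0
    have : ∀ n, f (s q * i n) = 0 := by
      intro n
      by_contra h
      exact hq ⟨s q * i n, subset_tsupport _ h, by rw [hfib', hs]⟩
    simp [this]
  have hFn : ∀ f : G → ℝ, (∀ x, 0 ≤ f x) → 0 ≤ F f := by
    intro f hf q
    exact integral_nonneg fun n => hf _
  have hint2 : ∀ f : G → ℝ, InC00plus f → Integrable (F f) μ := fun f hf =>
    (hFc f hf.1).integrable_of_hasCompactSupport (hFs f hf.2.1)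
  refine ⟨fun f => ∫ q, F f q ∂μ, ?_, ?_, ?_, ?_⟩
  · intro f hf
    exact integral_nonneg (hFn f hf.2.2)
  · intro f hf hne
    obtain ⟨x, hx⟩ := Function.ne_iff.mp hne
    refine (hFc f hf.1).integral_pos_of_hasCompactSupport_nonneg_nonzero (x := π x)
      (hFs f hf.2.1) (hFn f hf.2.2) ?_
    rw [hF]
    refine ne_of_gt ((hcont1 f hf.1 x).integral_pos_of_hasCompactSupport_nonneg_nonzero (x := 1)
      (HasCompactSupport.of_compactSpace _) (fun n => hf.2.2 _) ?_)
    rw [h1]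
    exact hx
  · intro n f α hf hα
    have : F (fun x => ∑ i, α i * f i x) = fun q => ∑ i, α i * F (f i) q := by
      funext q
      change ∫ n, (∑ j, α j * f j (s q * i n)) ∂ν = ∑ j, α j * ∫ n, f j (s q * i n) ∂ν
      rw [integral_finsetSum _ (fun j _ => (hint1 (f j) (hf j).1 (s q)).const_mul (α j))]
      simp only [integral_const_mul]
    change ∫ q, F (fun x => ∑ i, α i * f i x) q ∂μ = _
    rw [this, integral_finsetSum _ (fun j _ => (hint2 (f j) (hf j)).const_mul (α j))]
    simp only [integral_const_mul]
  · intro b f hf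
    have : F (fun x => f (b * x)) = fun q => F f (π b * q) := by
      funext q
      have e : π b * q = π (b * s q) := by rw [hπm, hs]
      rw [e, hF]
      simp only [has']
      rfl
    change ∫ q, F (fun x => f (b * x)) q ∂μ = _
    rw [this]
    exact integral_mul_left_eq_self (F f) (π b)

section flalg
variable {G : Type*} [FanLoop G]

lemma fl_lc {a x y : G} (h : a * x = a * y) : x = y :=
  (ldiv_unique a x (a * y) h).trans (ldiv_unique a y (a * y) rfl).symm

lemma fl_rc {a x y : G} (h : x * a = y * a) : x = y :=
  (rdiv_unique a x (y * a) h).trans (rdiv_unique a y (y * a) rfl).symm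

structure FLGood (N : Set G) : Prop where
  nuc : N ⊆ nucleus G
  one : (1 : G) ∈ N
  mul : ∀ x ∈ N, ∀ y ∈ N, x * y ∈ N
  inv : ∀ x ∈ N, ldiv x 1 ∈ N

structure FLNormal (N : Set G) : Prop extends FLGood N where
  nr : ∀ a, ∀ n ∈ N, ∃ m ∈ N, n * a = a * m
  assoc : ∀ a b c : G, ∃ n ∈ N, (a * b) * c = (a * (b * c)) * n

lemma FLGood.l {N : Set G} (h : FLGood N) {n : G} (hn : n ∈ N) (b c : G) :
    (n * b) * c = n * (b * c) := (h.nuc hn).1 b c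
lemma FLGood.m {N : Set G} (h : FLGood N) {n : G} (hn : n ∈ N) (b c : G) :
    (b * n) * c = b * (n * c) := (h.nuc hn).2.1 b c
lemma FLGood.r {N : Set G} (h : FLGood N) {n : G} (hn : n ∈ N) (b c : G) :
    (b * c) * n = b * (c * n) := (h.nuc hn).2.2 b c
lemma FLGood.inv_mul {N : Set G} (h : FLGood N) {n : G} (hn : n ∈ N) : ldiv n 1 * n = 1 := by
  apply fl_lc (a := n)
  rw [← h.l hn, mul_ldiv, FanLoop.one_mul, FanLoop.mul_one]

lemma fl_normal {N₀ : Set G} (h : FLGood N₀) (ht : ∀ a b c : G, t a b c ∈ N₀) :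
    FLNormal {n | n ∈ N₀ ∧ ∀ a : G, rdiv (a * n) a ∈ N₀} := by
  set N : Set G := {n | n ∈ N₀ ∧ ∀ a : G, rdiv (a * n) a ∈ N₀} with hN
  have memN : ∀ n, n ∈ N ↔ n ∈ N₀ ∧ ∀ a : G, ∃ m ∈ N₀, a * n = m * a := by
    intro n
    refine and_congr_right fun _ => forall_congr' fun a => ⟨fun h => ⟨_, h, (rdiv_mul _ _).symm⟩, ?_⟩
    rintro ⟨m, hm, e⟩
    rw [← rdiv_unique a m _ e.symm]
    exact hm
  have good : FLGood N := by
    refine ⟨fun x hx => h.nuc hx.1, ?_, ?_, ?_⟩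
    · rw [memN]
      exact ⟨h.one, fun a => ⟨1, h.one, by rw [FanLoop.one_mul, FanLoop.mul_one]⟩⟩
    · intro x hx y hy
      rw [memN] at *
      refine ⟨h.mul x hx.1 y hy.1, fun a => ?_⟩
      obtain ⟨m, hm, e⟩ := hx.2 a
      obtain ⟨k, hk, e'⟩ := hy.2 a
      refine ⟨m * k, h.mul _ hm _ hk, ?_⟩
      rw [← h.m hx.1, e, h.l hm, e', h.l hm]
    · intro x hx
      rw [memN] at *
      refine ⟨h.inv x hx.1, fun a => ?_⟩
      obtain ⟨m, hm, e⟩ := hx.2 a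
      refine ⟨ldiv m 1, h.inv m hm, ?_⟩
      apply fl_rc (a := x)
      rw [h.m (h.inv x hx.1), h.inv_mul hx.1, h.l (h.inv m hm), e, ← h.l (h.inv m hm),
        h.inv_mul hm, FanLoop.mul_one, FanLoop.one_mul]
  have conj : ∀ a, ∀ n ∈ N, ∃ m ∈ N, a * n = m * a := by
    intro a n hn
    have hn' := (memN n).1 hn
    obtain ⟨m, hm, e⟩ := hn'.2 a
    refine ⟨m, (memN m).2 ⟨hm, fun b => ?_⟩, e⟩
    obtain ⟨k, hk, e'⟩ := hn'.2 (b * a)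
    refine ⟨k, hk, ?_⟩
    apply fl_rc (a := a)
    rw [h.m hm, ← e, ← h.r hn'.1, e', h.l hk]
  have tN : ∀ b c d : G, t b c d ∈ N := by
    intro b c d
    rw [memN]
    refine ⟨ht _ _ _, fun a => ?_⟩
    have key : t a b c * (t a (b * c) d * (a * t b c d)) = t (a * b) c d * (t a b (c * d) * a) := by
      apply fl_rc (a := b * (c * d))
      rw [h.l (ht _ _ _), h.l (ht _ _ _), h.m (ht _ _ _), ← t_spec b c d, ← t_spec a (b * c) d,
        ← h.l (ht _ _ _), ← t_spec a b c, h.l (ht _ _ _), h.l (ht _ _ _), ← t_spec a b (c * d),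
        ← t_spec (a * b) c d]
    refine ⟨ldiv (t a (b * c) d) 1 * (ldiv (t a b c) 1 * (t (a * b) c d * t a b (c * d))),
      h.mul _ (h.inv _ (ht _ _ _)) _ (h.mul _ (h.inv _ (ht _ _ _)) _
        (h.mul _ (ht _ _ _) _ (ht _ _ _))), ?_⟩
    rw [h.l (h.inv _ (ht _ _ _)), h.l (h.inv _ (ht _ _ _)), h.l (ht _ _ _), ← key,
      ← h.l (h.inv _ (ht a b c)) (t a b c), h.inv_mul (ht _ _ _), FanLoop.one_mul,
      ← h.l (h.inv _ (ht _ _ _)), h.inv_mul (ht _ _ _), FanLoop.one_mul]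
  have nr : ∀ a, ∀ n ∈ N, ∃ m ∈ N, n * a = a * m := by
    intro a n hn
    have ha' := rdiv_mul a (1 : G)
    set a' := rdiv 1 a
    have hu : a * a' ∈ N := by
      have : a * a' = t a a' a := by
        apply fl_rc (a := a)
        rw [t_spec a a' a, ha', FanLoop.mul_one]
      rw [this]
      exact tN _ _ _
    set u := a * a' with hudef
    -- want n = φ φ' w with w = u⁻¹ n u
    have hui := good.inv u hu
    have hw : ldiv u 1 * (n * u) ∈ N := good.mul _ hui _ (good.mul _ hn _ hu)
    obtain ⟨m, hm, e⟩ := conj a' _ hw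
    obtain ⟨k, hk, e'⟩ := conj a m hm
    refine ⟨m, hm, ?_⟩
    have : n = k := by
      apply fl_rc (a := u)
      calc n * u = u * (ldiv u 1 * (n * u)) := by
            rw [← good.l hu, mul_ldiv, FanLoop.one_mul]
        _ = a * (a' * (ldiv u 1 * (n * u))) := by
            rw [← good.r hw, ← hudef]
        _ = k * u := by rw [e, ← good.m hm, e', good.l hk, ← hudef]
    rw [this, e']
  refine ⟨good, nr, fun a b c => ?_⟩
  obtain ⟨m, hm, e⟩ := nr (a * (b * c)) _ (tN a b c)
  exact ⟨m, hm, by rw [← e, ← t_spec]⟩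

@[reducible]
def FLGood.group {N : Set G} (h : FLGood N) : Group N where
  mul x y := ⟨x.1 * y.1, h.mul _ x.2 _ y.2⟩
  one := ⟨1, h.one⟩
  inv x := ⟨ldiv x.1 1, h.inv _ x.2⟩
  mul_assoc x y z := Subtype.ext (h.l x.2 y.1 z.1)
  one_mul x := Subtype.ext (FanLoop.one_mul _)
  mul_one x := Subtype.ext (FanLoop.mul_one _)
  inv_mul_cancel x := Subtype.ext (h.inv_mul x.2)

def FLGood.setoid {N : Set G} (h : FLGood N) : Setoid G where
  r x y := ∃ n ∈ N, y = x * n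
  iseqv := by
    refine ⟨fun x => ⟨1, h.one, (FanLoop.mul_one x).symm⟩, ?_, ?_⟩
    · rintro x _ ⟨n, hn, rfl⟩
      exact ⟨_, h.inv n hn, by rw [h.m hn, mul_ldiv, FanLoop.mul_one]⟩
    · rintro x _ _ ⟨n, hn, rfl⟩ ⟨m, hm, rfl⟩
      exact ⟨_, h.mul n hn m hm, h.m hn _ _⟩

@[reducible]
def FLNormal.group {N : Set G} (h : FLNormal N) : Group (Quotient h.setoid) where
  mul := Quotient.map₂ (fun x y => x * y) (by
    rintro x _ ⟨n, hn, rfl⟩ y _ ⟨m, hm, rfl⟩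
    obtain ⟨k, hk, e⟩ := h.nr y n hn
    refine ⟨k * m, h.mul _ hk _ hm, ?_⟩
    show (x * n) * (y * m) = (x * y) * (k * m)
    rw [h.m hn, ← h.l hn, e, h.m hk, ← h.r (h.mul _ hk _ hm)])
  one := Quotient.mk _ 1
  inv := Quotient.map (fun x => ldiv x 1) (by
    rintro x _ ⟨n, hn, rfl⟩
    obtain ⟨k, hk, e⟩ := h.nr (ldiv (x * n) 1) n hn
    refine ⟨_, h.inv k hk, ?_⟩
    show ldiv (x * n) 1 = ldiv x 1 * ldiv k 1
    apply fl_lc (a := x)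
    rw [← h.r (h.inv k hk), mul_ldiv, FanLoop.one_mul]
    apply fl_rc (a := k)
    rw [h.r hk, ← e, ← h.m hn, mul_ldiv, h.inv_mul hk])
  mul_assoc := by
    rintro ⟨x⟩ ⟨y⟩ ⟨z⟩
    obtain ⟨n, hn, e⟩ := h.assoc x y z
    exact (Quotient.sound (s := h.setoid) ⟨n, hn, e⟩).symm
  one_mul := by
    rintro ⟨x⟩
    exact congrArg (Quotient.mk h.setoid) (FanLoop.one_mul x)
  mul_one := by
    rintro ⟨x⟩
    exact congrArg (Quotient.mk h.setoid) (FanLoop.mul_one x)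
  inv_mul_cancel := by
    rintro ⟨x⟩
    refine Quotient.sound (s := h.setoid) ?_
    obtain ⟨n, hn, e⟩ := h.assoc x (ldiv x 1) x
    refine ⟨n, hn, ?_⟩
    apply fl_lc (a := x)
    show x * 1 = x * ((ldiv x 1 * x) * n)
    rw [← h.r hn, ← e, mul_ldiv, FanLoop.one_mul, FanLoop.mul_one]

end flalg

lemma fl_main {G : Type*} [TopologicalSpace G] [LocallyCompactSpace G] [FanLoop G]
    (hm : Continuous fun q : G × G => q.1 * q.2)
    (hl : Continuous fun q : G × G => ldiv q.1 q.2)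
    {N : Set G} (hcpt : IsCompact N) (h : FLNormal N) :
    ∃ J : (G → ℝ) → ℝ,
      (∀ f : G → ℝ, InC00plus f → 0 ≤ J f) ∧
      (∀ f : G → ℝ, InC00plus f → f ≠ 0 → 0 < J f) ∧
      (∀ (n : ℕ) (f : Fin n → G → ℝ) (α : Fin n → ℝ),
        (∀ i, InC00plus (f i)) → (∀ i, 0 ≤ α i) →
        J (fun x => ∑ i, α i * f i x) = ∑ i, α i * J (f i)) ∧
      (∀ (b : G) (f : G → ℝ), InC00plus f → J (fun x => f (b * x)) = J f) := by
  let : Group N := h.toFLGood.group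
  let : Group (Quotient h.setoid) := h.group
  have : CompactSpace N := isCompact_iff_compactSpace.mp hcpt
  have : IsTopologicalGroup N :=
    { continuous_mul := by
        refine Continuous.subtype_mk (f := fun q : N × N => q.1.1 * q.2.1) ?_ _
        exact hm.comp ((continuous_subtype_val.comp continuous_fst).prodMk
          (continuous_subtype_val.comp continuous_snd))
      continuous_inv := by
        refine Continuous.subtype_mk (f := fun q : N => ldiv q.1 1) ?_ _
        exact hl.comp (continuous_subtype_val.prodMk continuous_const) }
  have hopen : IsOpenMap (Quotient.mk h.setoid) := by
    intro U hU
    rw [← isQuotientMap_quotient_mk'.isOpen_preimage]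
    have : Quotient.mk h.setoid ⁻¹' (Quotient.mk h.setoid '' U)
        = ⋃ n : N, (fun x => x * n.1) ⁻¹' U := by
      ext x
      simp only [Set.mem_preimage, Set.mem_image, Set.mem_iUnion]
      constructor
      · rintro ⟨y, hy, e⟩
        obtain ⟨n, hn, rfl⟩ := Quotient.exact e.symm
        exact ⟨⟨n, hn⟩, hy⟩
      · rintro ⟨n, hn⟩
        exact ⟨_, hn, (Quotient.sound (s := h.setoid) ⟨n.1, n.2, rfl⟩).symm⟩
    erw [this]
    exact isOpen_iUnion fun n => hU.preimage (hm.comp (continuous_id.prodMk continuous_const))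
  have hπ : IsOpenQuotientMap (Quotient.mk h.setoid) :=
    ⟨Quotient.mk_surjective, continuous_quotient_mk', hopen⟩
  have : LocallyCompactSpace (Quotient h.setoid) := hπ.locallyCompactSpace
  have : IsTopologicalGroup (Quotient h.setoid) :=
    { continuous_mul := by
        rw [← (hπ.prodMap hπ).continuous_comp_iff]
        exact hπ.continuous.comp hm
      continuous_inv := by
        rw [← hπ.continuous_comp_iff]
        exact hπ.continuous.comp (hl.comp (continuous_id.prodMk continuous_const)) }
  refine fl_core hm (Subtype.val : N → G) continuous_subtype_val (Quotient.mk h.setoid) hπ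
    (fun a b => rfl) ?_ ?_ ?_ ?_ ?_
  · intro x y e
    obtain ⟨n, hn, e⟩ := Quotient.exact e
    exact ⟨⟨n, hn⟩, e⟩
  · intro x n
    exact (Quotient.sound (s := h.setoid) ⟨n.1, n.2, rfl⟩).symm
  · intro x m n
    exact h.m m.2 _ _
  · intro b x n
    exact h.r n.2 _ _
  · intro x
    exact FanLoop.mul_one x

/-- Theorem 3.15 of Ludkowski: existence of a nontrivial nonnegative linear left
invariant functional on C₀₀⁺(G) for a T1 locally compact topological fan loop
satisfying condition (3.5.2). -/
theorem fanLoop_exists_left_invariant_functional {G : Type*} [TopologicalSpace G]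
    [T1Space G] [LocallyCompactSpace G] [FanLoop G]
    (hm : Continuous fun q : G × G => q.1 * q.2)
    (hl : Continuous fun q : G × G => ldiv q.1 q.2)
    (hr : Continuous fun q : G × G => rdiv q.1 q.2)
    -- Condition (3.5.2): a compact subgroup N₀ of the nucleus containing all t, p values
    (N₀ : Set G) (hcpt : IsCompact N₀) (hsub : N₀ ⊆ nucleus G) (h1 : (1 : G) ∈ N₀)
    (hmulc : ∀ x ∈ N₀, ∀ y ∈ N₀, x * y ∈ N₀) (hinvc : ∀ x ∈ N₀, ldiv x 1 ∈ N₀)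
    (ht : ∀ a b c : G, t a b c ∈ N₀) (hp : ∀ a b c : G, p a b c ∈ N₀) :
    ∃ J : (G → ℝ) → ℝ,
      (∀ f : G → ℝ, InC00plus f → 0 ≤ J f) ∧
      (∀ f : G → ℝ, InC00plus f → f ≠ 0 → 0 < J f) ∧
      (∀ (n : ℕ) (f : Fin n → G → ℝ) (α : Fin n → ℝ),
        (∀ i, InC00plus (f i)) → (∀ i, 0 ≤ α i) →
        J (fun x => ∑ i, α i * f i x) = ∑ i, α i * J (f i)) ∧
      (∀ (b : G) (f : G → ℝ), InC00plus f → J (fun x => f (b * x)) = J f) := by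
  have hcl : IsClosed N₀ := by
    have : T2Space G := by
      rw [t2_iff_isClosed_diagonal]
      have : Set.diagonal G = (fun q : G × G => ldiv q.1 q.2) ⁻¹' {1} := by
        ext ⟨x, y⟩
        simp only [Set.mem_diagonal_iff, Set.mem_preimage, Set.mem_singleton_iff]
        constructor
        · rintro rfl
          exact (ldiv_unique x 1 x (FanLoop.mul_one x)).symm
        · intro e
          have := mul_ldiv x y
          rwa [e, FanLoop.mul_one] at this
      rw [this]
      exact isClosed_singleton.preimage hl
    exact hcpt.isClosed
  have hg : FLGood N₀ := ⟨hsub, h1, hmulc, hinvc⟩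
  refine fl_main hm hl (hcpt.of_isClosed_subset ?_ fun x hx => hx.1) (fl_normal hg ht)
  have e : {n | n ∈ N₀ ∧ ∀ a : G, rdiv (a * n) a ∈ N₀}
      = N₀ ∩ ⋂ a : G, (fun n => rdiv (a * n) a) ⁻¹' N₀ := by
    ext n
    simp
  rw [e]
  refine hcl.inter (isClosed_iInter fun a => ?_)
  refine hcl.preimage (f := fun n => rdiv (a * n) a) ?_
  exact hr.comp ((hm.comp (continuous_const.prodMk continuous_id)).prodMk continuous_const)
end

section
/- Let G be a T1 topological locally compact fan loop satisfying Condition (3.5.2). Then there exists a σ-additive Borel measure μ on the Borel σ-algebra of G, with values in [0,∞], such that: (1) μ is regular, i.e. μ(U) = sup{μ(X) : X compact, X ⊆ U} for each open subset U of G, and μ(A) = inf{μ(V) : V open, A ⊆ V ⊆ G} for each Borel set A; (2) μ(U) > 0 for each nonempty open subset U of G; (3) μ(A) < ∞ for each compact subset A of G; (4) μ is left invariant: μ(bB) = μ(B) for each Borel set B ⊆ G and each b ∈ G, where bB = {bx : x ∈ B}. -/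
open FanLoop

open MeasureTheory Topology in
theorem fl_abstract {G H K : Type*} [TopologicalSpace G] [T2Space G] [LocallyCompactSpace G]
    [MeasurableSpace G] [BorelSpace G] [Mul G]
    [Group H] [TopologicalSpace H] [IsTopologicalGroup H] [LocallyCompactSpace H]
    [Group K] [TopologicalSpace K] [IsTopologicalGroup K] [CompactSpace K]
    (hm : Continuous fun q : G × G => q.1 * q.2)
    (L : G → G ≃ₜ G) (hL : ∀ b x, L b x = b * x)
    (π : G → H) (hπ : IsOpenQuotientMap π) (hπm : ∀ a b, π (a * b) = π a * π b)
    (ι : K → G) (hι : Continuous ι)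
    (h1 : ∀ x, x * ι 1 = x)
    (hk : ∀ x k k', (x * ι k) * ι k' = x * ι (k * k'))
    (hb : ∀ b x k, (b * x) * ι k = b * (x * ι k))
    (hπk : ∀ x k, π (x * ι k) = π x)
    (hfib : ∀ x y, π x = π y → ∃ k, y = x * ι k) :
    ∃ μ : Measure G,
      (∀ U : Set G, IsOpen U → μ U = ⨆ (K : Set G) (_ : IsCompact K) (_ : K ⊆ U), μ K) ∧
      (∀ A : Set G, MeasurableSet A → μ A = ⨅ (V : Set G) (_ : IsOpen V) (_ : A ⊆ V), μ V) ∧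
      (∀ U : Set G, IsOpen U → U.Nonempty → 0 < μ U) ∧
      (∀ K : Set G, IsCompact K → μ K < ⊤) ∧
      (∀ B : Set G, MeasurableSet B → ∀ b : G, μ ((b * ·) '' B) = μ B) := by
  let : MeasurableSpace H := borel H
  have : BorelSpace H := ⟨rfl⟩
  let : MeasurableSpace K := borel K
  have : BorelSpace K := ⟨rfl⟩
  let ν : Measure H := Measure.haar
  let κ : Measure K := Measure.haar
  let F : (G → ℝ) → H → ℝ := fun f h => ∫ k, f (Function.surjInv hπ.surjective h * ι k) ∂κ
  have hF : ∀ f x, F f (π x) = ∫ k, f (x * ι k) ∂κ := by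
    intro f x
    obtain ⟨k₀, h0⟩ := hfib x (Function.surjInv hπ.surjective (π x))
      (Function.surjInv_eq hπ.surjective _).symm
    simp only [F]
    rw [h0]
    simp only [hk]
    exact integral_mul_left_eq_self (fun k => f (x * ι k)) k₀
  have hcont : ∀ f : CompactlySupportedContinuousMap G ℝ, ∀ x,
      Continuous fun k => f (x * ι k) := fun f x =>
    f.continuous.comp (hm.comp (continuous_const.prodMk hι))
  have hcs : ∀ g : K → ℝ, HasCompactSupport g := fun g => HasCompactSupport.of_compactSpace g
  have hint : ∀ f : CompactlySupportedContinuousMap G ℝ, ∀ x,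
      Integrable (fun k => f (x * ι k)) κ := fun f x =>
    (hcont f x).integrable_of_hasCompactSupport (hcs _)
  have hFc : ∀ f : CompactlySupportedContinuousMap G ℝ, Continuous (F f) := by
    intro f
    rw [hπ.isQuotientMap.continuous_iff]
    have : F f ∘ π = fun x => ∫ k, f (x * ι k) ∂κ := funext (hF f)
    rw [this, ← continuousOn_univ]
    refine continuousOn_integral_of_compact_support (k := Set.univ) isCompact_univ ?_ (by simp)
    refine Continuous.continuousOn ?_
    exact f.continuous.comp (hm.comp (continuous_fst.prodMk (hι.comp continuous_snd)))
  have hFs : ∀ f : CompactlySupportedContinuousMap G ℝ, HasCompactSupport (F f) := by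
    intro f
    refine HasCompactSupport.intro (f.hasCompactSupport.isCompact.image hπ.continuous) ?_
    intro h hh
    obtain ⟨x, rfl⟩ := hπ.surjective h
    rw [hF]
    refine integral_eq_zero_of_ae (Filter.Eventually.of_forall fun k => ?_)
    by_contra hne
    exact hh ⟨x * ι k, subset_tsupport _ hne, hπk x k⟩
  have hFi : ∀ f : CompactlySupportedContinuousMap G ℝ, Integrable (F f) ν := fun f =>
    (hFc f).integrable_of_hasCompactSupport (hFs f)
  have hFn : ∀ f : CompactlySupportedContinuousMap G ℝ, (∀ x, 0 ≤ f x) → 0 ≤ F f := fun f hf h =>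
    integral_nonneg fun k => hf _
  let Λ₀ : CompactlySupportedContinuousMap G ℝ →ₗ[ℝ] ℝ :=
    { toFun := fun f => ∫ h, F f h ∂ν
      map_add' := by
        intro f g
        rw [← integral_add (hFi f) (hFi g)]
        congr 1
        funext h
        exact integral_add (hint f _) (hint g _)
      map_smul' := by
        intro c f
        rw [RingHom.id_apply, ← integral_smul]
        congr 1
        funext h
        exact integral_smul c _ }
  let Λ : CompactlySupportedContinuousMap G ℝ →ₚ[ℝ] ℝ :=
    PositiveLinearMap.mk₀ Λ₀ (fun f hf => integral_nonneg (hFn f hf))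
  have hΛ : ∀ f : CompactlySupportedContinuousMap G ℝ,
      ∫ x, f x ∂(RealRMK.rieszMeasure Λ) = ∫ h, F f h ∂ν := fun f =>
    RealRMK.integral_rieszMeasure Λ f
  generalize hμ : RealRMK.rieszMeasure Λ = μ at hΛ
  have : μ.Regular := hμ ▸ RealRMK.regular_rieszMeasure Λ
  refine ⟨μ, ?_, ?_, ?_, ?_, ?_⟩
  · intro U hU
    rw [hU.measure_eq_iSup_isCompact]
    exact iSup_congr fun K => iSup_comm
  · intro A _
    rw [A.measure_eq_iInf_isOpen]
    exact iInf_congr fun K => iInf_comm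
  · intro U hU ⟨x, hx⟩
    obtain ⟨f, hf1, hf0, hfs, hfI⟩ := exists_continuous_one_zero_of_isCompact
      (isCompact_singleton (x := x)) hU.isClosed_compl
      (Set.disjoint_compl_right_iff_subset.2 (Set.singleton_subset_iff.2 hx))
    let f' : CompactlySupportedContinuousMap G ℝ := ⟨f, hfs⟩
    have hf'n : ∀ y, 0 ≤ f' y := fun y => (hfI y).1
    have hpos : 0 < F f' (π x) := by
      rw [hF]
      refine (hcont f' x).integral_pos_of_hasCompactSupport_nonneg_nonzero (x := 1) (hcs _)
        (fun k => hf'n _) ?_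
      rw [h1]
      have : f' x = 1 := hf1 rfl
      rw [this]; exact one_ne_zero
    have hpos2 : 0 < ∫ h, F f' h ∂ν :=
      (hFc f').integral_pos_of_hasCompactSupport_nonneg_nonzero (hFs f') (hFn f' hf'n) hpos.ne'
    rw [← hΛ] at hpos2
    rw [pos_iff_ne_zero]
    intro h0
    refine hpos2.ne' (integral_eq_zero_of_ae ?_)
    have : ∀ᵐ y ∂μ, y ∉ U := measure_eq_zero_iff_ae_notMem.1 h0
    filter_upwards [this] with y hy
    exact hf0 hy
  · intro A hA
    exact hA.measure_lt_top
  · intro B hB b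
    have := Measure.Regular.map (μ := μ) (L b)
    have hinv : Measure.map (L b) μ = μ := by
      refine Measure.ext_of_integral_eq_on_compactlySupported fun f => ?_
      rw [(L b).measurableEmbedding.integral_map]
      let g : CompactlySupportedContinuousMap G ℝ :=
        ⟨⟨fun x => f (L b x), f.continuous.comp (L b).continuous⟩,
          f.hasCompactSupport.comp_homeomorph (L b)⟩
      have hg : ∀ x, g x = f (b * x) := fun x => by rw [← hL]; rfl
      change ∫ x, g x ∂μ = _
      rw [hΛ, hΛ]
      have : ∀ h, F g h = F f (π b * h) := by
        intro h
        obtain ⟨x, rfl⟩ := hπ.surjective h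
        rw [← hπm, hF, hF]
        simp only [hg, hb]
      simp only [this]
      exact integral_mul_left_eq_self (F f) (π b)
    have himg : (b * ·) '' B = L b '' B := Set.image_congr fun x _ => (hL b x).symm
    rw [himg]
    conv_lhs => rw [← hinv]
    rw [(L b).measurableEmbedding.map_apply, Set.preimage_image_eq _ (L b).injective]

open MeasureTheory in
/-- Theorem 3.16 of Ludkowski: existence of a nontrivial left invariant regular Borel
measure on a T1 locally compact topological fan loop satisfying condition (3.5.2). -/
theorem fanLoop_exists_left_invariant_measure {G : Type*} [TopologicalSpace G]
    [T1Space G] [LocallyCompactSpace G] [FanLoop G]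
    [MeasurableSpace G] [BorelSpace G]
    (hm : Continuous fun q : G × G => q.1 * q.2)
    (hl : Continuous fun q : G × G => ldiv q.1 q.2)
    (hr : Continuous fun q : G × G => rdiv q.1 q.2)
    -- Condition (3.5.2): a compact subgroup N₀ of the nucleus containing all t, p values
    (N₀ : Set G) (hcpt : IsCompact N₀) (hsub : N₀ ⊆ nucleus G) (h1 : (1 : G) ∈ N₀)
    (hmulc : ∀ x ∈ N₀, ∀ y ∈ N₀, x * y ∈ N₀) (hinvc : ∀ x ∈ N₀, ldiv x 1 ∈ N₀)
    (ht : ∀ a b c : G, t a b c ∈ N₀) (hp : ∀ a b c : G, p a b c ∈ N₀) :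
    ∃ μ : Measure G,
      (∀ U : Set G, IsOpen U → μ U = ⨆ (K : Set G) (_ : IsCompact K) (_ : K ⊆ U), μ K) ∧
      (∀ A : Set G, MeasurableSet A → μ A = ⨅ (V : Set G) (_ : IsOpen V) (_ : A ⊆ V), μ V) ∧
      (∀ U : Set G, IsOpen U → U.Nonempty → 0 < μ U) ∧
      (∀ K : Set G, IsCompact K → μ K < ⊤) ∧
      (∀ B : Set G, MeasurableSet B → ∀ b : G, μ ((b * ·) '' B) = μ B) := by
  have om : ∀ a : G, 1 * a = a := FanLoop.one_mul
  have mo : ∀ a : G, a * 1 = a := FanLoop.mul_one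
  have lc : ∀ a x y : G, a * x = a * y → x = y := fun a x y h =>
    (FanLoop.ldiv_unique a x _ h).trans (FanLoop.ldiv_unique a y _ rfl).symm
  have ldm : ∀ a x : G, ldiv a (a * x) = x := fun a x => (FanLoop.ldiv_unique a x _ rfl).symm
  have rdm : ∀ a x : G, rdiv (x * a) a = x := fun a x => (FanLoop.rdiv_unique a x _ rfl).symm
  have nl : ∀ n ∈ N₀, ∀ b c : G, (n * b) * c = n * (b * c) := fun n hn => (hsub hn).1
  have nm : ∀ n ∈ N₀, ∀ b c : G, (b * n) * c = b * (n * c) := fun n hn => (hsub hn).2.1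
  have nr : ∀ n ∈ N₀, ∀ b c : G, (b * c) * n = b * (c * n) := fun n hn => (hsub hn).2.2
  have ri : ∀ n : G, n * ldiv n 1 = 1 := fun n => FanLoop.mul_ldiv n 1
  have li : ∀ n ∈ N₀, ldiv n 1 * n = 1 := fun n hn => by
    apply lc n
    rw [← nl n hn, ri, om, mo]
  have hassoc : ∀ a b c : G, ∃ m ∈ N₀, (a * b) * c = (a * (b * c)) * m := fun a b c =>
    ⟨p a b c, hp a b c, FanLoop.p_spec a b c⟩
  have : T2Space G := by
    rw [t2_iff_isClosed_diagonal]
    have : Set.diagonal G = (fun q : G × G => ldiv q.1 q.2) ⁻¹' {1} := by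
      ext ⟨a, b⟩
      simp only [Set.mem_diagonal_iff, Set.mem_preimage, Set.mem_singleton_iff]
      constructor
      · rintro rfl
        exact (FanLoop.ldiv_unique a 1 a (mo a)).symm
      · intro h
        have := FanLoop.mul_ldiv a b
        rw [h, mo] at this
        exact this
    rw [this]
    exact isClosed_singleton.preimage hl
  let Ks : Set G := {n | n ∈ N₀ ∧ ∀ x, ∃ m ∈ N₀, n * x = x * m}
  have K1 : (1 : G) ∈ Ks := ⟨h1, fun x => ⟨1, h1, by rw [om, mo]⟩⟩
  have Kmul : ∀ k ∈ Ks, ∀ k' ∈ Ks, k * k' ∈ Ks := by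
    rintro k ⟨hk, hk2⟩ k' ⟨hk', hk2'⟩
    refine ⟨hmulc k hk k' hk', fun x => ?_⟩
    obtain ⟨m', hm', e'⟩ := hk2' x
    obtain ⟨m, hm, e⟩ := hk2 x
    refine ⟨m * m', hmulc m hm m' hm', ?_⟩
    rw [nl k hk, e', ← nl k hk, e, nm m hm]
  have Kinv : ∀ k ∈ Ks, ldiv k 1 ∈ Ks := by
    rintro k ⟨hk, hk2⟩
    refine ⟨hinvc k hk, fun x => ?_⟩
    obtain ⟨m, hm, e⟩ := hk2 x
    refine ⟨ldiv m 1, hinvc m hm, ?_⟩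
    apply lc k
    rw [← nl k hk, ri, om, ← nl k hk, e, nm m hm, ri, mo]
  have Knorm : ∀ k ∈ Ks, ∀ b : G, ∃ k' ∈ Ks, k * b = b * k' := by
    rintro k ⟨hk, hk2⟩ b
    obtain ⟨m, hm, e⟩ := hk2 b
    refine ⟨m, ⟨hm, fun x => ?_⟩, e⟩
    obtain ⟨n, hn, e'⟩ := hk2 (b * x)
    refine ⟨n, hn, ?_⟩
    apply lc b
    rw [← nm m hm, ← e, nl k hk, e', nr n hn]
  have Kassoc : ∀ a b c : G, ∃ k ∈ Ks, (a * b) * c = (a * (b * c)) * k := by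
    intro a b c
    obtain ⟨q, hq, e⟩ := hassoc a b c
    refine ⟨q, ⟨hq, fun x => ?_⟩, e⟩
    obtain ⟨m1, hm1, e1⟩ := hassoc (a * b) c x
    obtain ⟨m2, hm2, e2⟩ := hassoc a b (c * x)
    obtain ⟨m3, hm3, e3⟩ := hassoc a (b * c) x
    obtain ⟨m4, hm4, e4⟩ := hassoc b c x
    have h43 := hmulc m4 hm4 m3 hm3
    have h21 := hmulc m2 hm2 m1 hm1
    have hi := hinvc _ h43
    refine ⟨ldiv (m4 * m3) 1 * (m2 * m1), hmulc _ hi _ h21, ?_⟩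
    apply lc (a * (b * c))
    have E1 : (a * b) * c * x = (a * (b * (c * x))) * (m2 * m1) := by
      rw [e1, e2, nm m2 hm2]
    have E2 : (a * (b * c)) * x = (a * (b * (c * x))) * (m4 * m3) := by
      rw [e3, e4, ← nr m4 hm4, nm m4 hm4]
    rw [← nm q hq, ← e, E1, ← nr _ (hmulc _ hi _ h21), E2, nm _ h43, ← nm _ hi (m4 * m3), ri, om]
  have Kcpt : IsCompact Ks := by
    have : Ks = N₀ ∩ ⋂ x : G, (fun n => ldiv x (n * x)) ⁻¹' N₀ := by
      ext n
      simp only [Ks, Set.mem_ofPred_eq, Set.mem_inter_iff, Set.mem_iInter, Set.mem_preimage]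
      refine and_congr_right fun _ => forall_congr' fun x => ?_
      constructor
      · rintro ⟨m, hm, e⟩
        rw [e, ldm]
        exact hm
      · intro h
        exact ⟨_, h, (FanLoop.mul_ldiv x _).symm⟩
    rw [this]
    refine hcpt.inter_right (isClosed_iInter fun x => hcpt.isClosed.preimage ?_)
    exact hl.comp (continuous_const.prodMk (hm.comp (continuous_id.prodMk continuous_const)))
  have KN : ∀ k ∈ Ks, k ∈ N₀ := fun k hk => hk.1
  -- the compact group
  let _ : Mul Ks := ⟨fun a b => ⟨a.1 * b.1, Kmul _ a.2 _ b.2⟩⟩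
  let _ : One Ks := ⟨⟨1, K1⟩⟩
  let _ : Inv Ks := ⟨fun a => ⟨ldiv a.1 1, Kinv _ a.2⟩⟩
  let _ : Group Ks := Group.ofLeftAxioms
    (fun a b c => Subtype.ext (nl _ (KN _ a.2) _ _))
    (fun a => Subtype.ext (om _))
    (fun a => Subtype.ext (li _ (KN _ a.2)))
  have : IsTopologicalGroup Ks :=
    { continuous_mul := Continuous.subtype_mk (hm.comp
        ((continuous_subtype_val.comp continuous_fst).prodMk
          (continuous_subtype_val.comp continuous_snd))) _
      continuous_inv := Continuous.subtype_mk (hl.comp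
        (continuous_subtype_val.prodMk continuous_const)) _ }
  have : CompactSpace Ks := isCompact_iff_compactSpace.1 Kcpt
  -- the quotient group
  let S : Setoid G :=
    { r := fun a b => ∃ k ∈ Ks, b = a * k
      iseqv :=
        { refl := fun a => ⟨1, K1, (mo a).symm⟩
          symm := by
            rintro a b ⟨k, hk, rfl⟩
            exact ⟨ldiv k 1, Kinv k hk, by rw [nm k (KN k hk), ri, mo]⟩
          trans := by
            rintro a b c ⟨k, hk, rfl⟩ ⟨k', hk', rfl⟩
            exact ⟨k * k', Kmul k hk k' hk', nm k (KN k hk) _ _⟩ } }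
  let H := Quotient S
  let π : G → H := Quotient.mk S
  have πs : Function.Surjective π := Quotient.mk_surjective
  have πk : ∀ x, ∀ k ∈ Ks, π (x * k) = π x := fun x k hk =>
    (Quotient.sound (s := S) ⟨k, hk, rfl⟩).symm
  have πf : ∀ x y, π x = π y → ∃ k ∈ Ks, y = x * k := fun x y h => Quotient.exact (s := S) h
  let _ : Mul H := ⟨Quotient.map₂ (· * ·) (by
    rintro a _ ⟨k, hk, rfl⟩ b _ ⟨k', hk', rfl⟩
    obtain ⟨k'', hk'', e⟩ := Knorm k hk b
    refine ⟨k'' * k', Kmul _ hk'' _ hk', ?_⟩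
    change (a * k) * (b * k') = (a * b) * (k'' * k')
    rw [nm k (KN k hk), ← nl k (KN k hk), e, nm k'' (KN _ hk''),
      ← nr _ (KN _ (Kmul _ hk'' _ hk'))])⟩
  let _ : One H := ⟨π 1⟩
  let _ : Inv H := ⟨fun h => π (rdiv 1 h.out)⟩
  have πm : ∀ a b, π (a * b) = π a * π b := fun a b => rfl
  let _ : Group H := Group.ofLeftAxioms
    (by
      intro a b c
      obtain ⟨a, rfl⟩ := πs a
      obtain ⟨b, rfl⟩ := πs b
      obtain ⟨c, rfl⟩ := πs c
      rw [← πm, ← πm, ← πm, ← πm]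
      obtain ⟨k, hk, e⟩ := Kassoc a b c
      rw [e, πk _ k hk])
    (by
      intro a
      obtain ⟨a, rfl⟩ := πs a
      change π (1 * a) = π a
      rw [om])
    (by
      intro a
      change π (rdiv 1 a.out) * a = π 1
      have ha : π a.out = a := Quotient.out_eq a
      have hb : π (rdiv 1 a.out) * π a.out = π 1 := by
        rw [← πm, FanLoop.rdiv_mul]
      rwa [ha] at hb)
  have πi : ∀ a, (π a)⁻¹ = π (rdiv 1 a) := by
    intro a
    symm
    apply eq_inv_of_mul_eq_one_left
    rw [← πm, FanLoop.rdiv_mul]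
    rfl
  have πc : Continuous π := continuous_quotient_mk'
  have πo : IsOpenMap π := by
    intro U hU
    refine isOpen_coinduced.2 ?_
    have : Quotient.mk S ⁻¹' (π '' U) = ⋃ k ∈ Ks, (fun x => rdiv x k) ⁻¹' U := by
      ext x
      simp only [Set.mem_preimage, Set.mem_image, Set.mem_iUnion, exists_prop]
      constructor
      · rintro ⟨u, hu, e⟩
        obtain ⟨k, hk, rfl⟩ := πf u x e
        exact ⟨k, hk, by rwa [rdm]⟩
      · rintro ⟨k, hk, h⟩
        refine ⟨_, h, ?_⟩
        rw [← πk _ k hk, FanLoop.rdiv_mul]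
    change IsOpen (Quotient.mk S ⁻¹' (π '' U))
    rw [this]
    exact isOpen_biUnion fun k _ => hU.preimage (hr.comp (continuous_id.prodMk continuous_const))
  have hπ : IsOpenQuotientMap π := ⟨πs, πc, πo⟩
  have : IsTopologicalGroup H :=
    { continuous_mul := by
        rw [(hπ.prodMap hπ).isQuotientMap.continuous_iff]
        exact πc.comp hm
      continuous_inv := by
        rw [hπ.isQuotientMap.continuous_iff]
        have : (fun a : H => a⁻¹) ∘ π = fun a => π (rdiv 1 a) := funext πi
        rw [this]
        exact πc.comp (hr.comp (continuous_const.prodMk continuous_id)) }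
  have : LocallyCompactSpace H := hπ.locallyCompactSpace
  let L : G → G ≃ₜ G := fun b =>
    { toFun := fun x => b * x
      invFun := fun x => ldiv b x
      left_inv := fun x => ldm b x
      right_inv := fun x => FanLoop.mul_ldiv b x
      continuous_toFun := hm.comp (continuous_const.prodMk continuous_id)
      continuous_invFun := hl.comp (continuous_const.prodMk continuous_id) }
  exact fl_abstract (K := Ks) hm L (fun _ _ => rfl) π hπ πm Subtype.val continuous_subtype_val
    mo (fun x k k' => nm _ (KN _ k.2) _ _) (fun b x k => nr _ (KN _ k.2) _ _)
    (fun x k => πk x _ k.2)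
    (fun x y h => by
      obtain ⟨k, hk, e⟩ := πf x y h
      exact ⟨⟨k, hk⟩, e⟩)
end

section
/- Let G be a T1 topological locally compact fan loop satisfying Condition (3.5.2), and let μ be a σ-additive Borel measure on G that is regular (inner regular by compact sets on open sets and outer regular by open sets on Borel sets), positive on nonempty open sets, finite on compact sets, and left invariant (μ(bB) = μ(B) for all b ∈ G and Borel B ⊆ G). Then μ(G) < ∞ if and only if G is compact. -/
open FanLoop

open MeasureTheory in
/-- Theorem 3.19 of Ludkowski: a left invariant regular Borel measure on a T1 locally
compact topological fan loop satisfying (3.5.2) is finite iff the loop is compact. -/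
theorem fanLoop_measure_finite_iff_compact {G : Type*} [TopologicalSpace G]
    [T1Space G] [LocallyCompactSpace G] [FanLoop G]
    [MeasurableSpace G] [BorelSpace G]
    (hm : Continuous fun q : G × G => q.1 * q.2)
    (hl : Continuous fun q : G × G => ldiv q.1 q.2)
    (hr : Continuous fun q : G × G => rdiv q.1 q.2)
    -- Condition (3.5.2): a compact subgroup N₀ of the nucleus containing all t, p values
    (N₀ : Set G) (hcpt : IsCompact N₀) (hsub : N₀ ⊆ nucleus G) (h1 : (1 : G) ∈ N₀)
    (hmulc : ∀ x ∈ N₀, ∀ y ∈ N₀, x * y ∈ N₀) (hinvc : ∀ x ∈ N₀, ldiv x 1 ∈ N₀)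
    (ht : ∀ a b c : G, t a b c ∈ N₀) (hp : ∀ a b c : G, p a b c ∈ N₀)
    (μ : Measure G)
    (hreg₁ : ∀ U : Set G, IsOpen U → μ U = ⨆ (K : Set G) (_ : IsCompact K) (_ : K ⊆ U), μ K)
    (hreg₂ : ∀ A : Set G, MeasurableSet A →
      μ A = ⨅ (V : Set G) (_ : IsOpen V) (_ : A ⊆ V), μ V)
    (hpos : ∀ U : Set G, IsOpen U → U.Nonempty → 0 < μ U)
    (hfin : ∀ K : Set G, IsCompact K → μ K < ⊤)
    (hinv : ∀ B : Set G, MeasurableSet B → ∀ b : G, μ ((b * ·) '' B) = μ B) :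
    μ Set.univ < ⊤ ↔ IsCompact (Set.univ : Set G) := by
  have hcm : ∀ b : G, Continuous (fun x : G => b * x) := fun b =>
    hm.comp (continuous_const.prodMk continuous_id)
  have hT2 : T2Space G := by
    rw [t2_iff_isClosed_diagonal]
    have : Set.diagonal G = (fun q : G × G => ldiv q.1 q.2) ⁻¹' {1} := by
      ext ⟨a, b⟩
      simp only [Set.mem_diagonal_iff, Set.mem_preimage, Set.mem_singleton_iff]
      constructor
      · rintro rfl
        exact (FanLoop.ldiv_unique a 1 a (FanLoop.mul_one a)).symm
      · intro h
        have h2 := FanLoop.mul_ldiv a b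
        rw [h, FanLoop.mul_one] at h2
        exact h2
    rw [this]
    exact isClosed_singleton.preimage hl
  constructor
  · intro hfinite
    obtain ⟨V, hV, hV1⟩ := exists_compact_mem_nhds (1 : G)
    have hVm : ∀ b : G, IsCompact ((b * ·) '' V) := fun b => hV.image (hcm b)
    have hVpos : 0 < μ V :=
      lt_of_lt_of_le (hpos (interior V) isOpen_interior ⟨1, mem_interior_iff_mem_nhds.2 hV1⟩)
        (measure_mono interior_subset)
    by_contra hnc
    have key : ∀ s : Finset G, (∀ x ∈ s, True) →
        ∃ y : G, True ∧ ∀ x ∈ s, Disjoint ((x * ·) '' V) ((y * ·) '' V) := by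
      intro s _
      by_contra hcon
      push Not at hcon
      apply hnc
      have hK : IsCompact (⋃ b ∈ s, (fun q : G × G => rdiv (b * q.1) q.2) '' (V ×ˢ V)) := by
        apply s.isCompact_biUnion
        intro b _
        apply (hV.prod hV).image
        exact hr.comp (((hcm b).comp continuous_fst).prodMk continuous_snd)
      convert hK
      symm
      rw [Set.eq_univ_iff_forall]
      intro g
      obtain ⟨b, hb, hd⟩ := hcon g trivial
      rw [Set.not_disjoint_iff] at hd
      obtain ⟨z, ⟨w, hw, rfl⟩, ⟨v, hv, hgv⟩⟩ := hd
      simp only [Set.mem_iUnion]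
      exact ⟨b, hb, (w, v), ⟨hw, hv⟩, (FanLoop.rdiv_unique v g (b * w) hgv).symm⟩
    obtain ⟨f, -, hf⟩ := exists_seq_of_forall_finset_exists (fun _ : G => True)
      (fun x y => Disjoint ((x * ·) '' V) ((y * ·) '' V)) key
    have hdisj : Pairwise (Function.onFun Disjoint fun n => (f n * ·) '' V) := by
      intro m n hmn
      rcases lt_or_gt_of_ne hmn with h | h
      · exact hf m n h
      · exact (hf n m h).symm
    have hsum := measure_iUnion (μ := μ) hdisj (fun n => (hVm (f n)).isClosed.measurableSet)
    simp only [hinv V hV.isClosed.measurableSet] at hsum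
    rw [ENNReal.tsum_const_eq_top_of_ne_zero hVpos.ne'] at hsum
    exact absurd (hsum ▸ measure_mono (Set.subset_univ _)) (not_le.2 hfinite)
  · exact fun h => hfin _ h
end

section
/- Let G be a T1 topological locally compact fan loop satisfying Condition (3.5.2), and let J and H be functionals on C₀₀⁺(G) each satisfying: (1) J(f) ≥ 0 for each f ∈ C₀₀⁺(G), with J(f) > 0 for f not identically zero; (2) J(α₁f₁ + … + αₙfₙ) = α₁J(f₁) + … + αₙJ(fₙ) for all f₁, …, fₙ ∈ C₀₀⁺(G) and nonnegative α₁, …, αₙ; (3) J(f(b·)) = J(f) for each b ∈ G and f ∈ C₀₀⁺(G), where f(b·)(x) = f(bx); and likewise for H. Then there exists a positive constant κ such that H(f) = κ·J(f) for every f ∈ C₀₀⁺(G). -/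
open FanLoop

section FLauxSection
open MeasureTheory MeasureTheory.Measure Topology
open scoped NNReal ENNReal CompactlySupported

/-- A nonnegative additive, homogeneous functional is represented by a regular measure. -/
theorem FLaux.exists_measure {G : Type*} [TopologicalSpace G] [T2Space G] [LocallyCompactSpace G]
    [MeasurableSpace G] [BorelSpace G]
    (J : (G → ℝ) → ℝ)
    (h0 : ∀ f : G → ℝ, InC00plus f → 0 ≤ J f)
    (hadd : ∀ f g : G → ℝ, InC00plus f → InC00plus g → J (fun x => f x + g x) = J f + J g)
    (hsmul : ∀ (a : ℝ) (f : G → ℝ), 0 ≤ a → InC00plus f → J (fun x => a * f x) = a * J f)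
    (L : G → G ≃ₜ G)
    (hinv : ∀ (b : G) (f : G → ℝ), InC00plus f → J (fun x => f (L b x)) = J f) :
    ∃ μ : Measure G, μ.Regular ∧ (∀ f, InC00plus f → ∫ x, f x ∂μ = J f) ∧
      ∀ b, μ.map (L b) = μ := by
  have key : ∀ f : C_c(G, ℝ≥0), InC00plus (fun x => (f x : ℝ)) := fun f =>
    ⟨by fun_prop, f.hasCompactSupport.comp_left (g := fun r : ℝ≥0 => (r : ℝ)) rfl,
      fun x => (f x).2⟩
  let Λ : C_c(G, ℝ≥0) →ₗ[ℝ≥0] ℝ≥0 :=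
    { toFun := fun f => ⟨J (fun x => (f x : ℝ)), h0 _ (key f)⟩
      map_add' := by
        intro f g
        ext
        change J (fun x => ((f x + g x : ℝ≥0) : ℝ)) = J _ + J _
        simpa using hadd _ _ (key f) (key g)
      map_smul' := by
        intro a f
        ext
        change J (fun x => ((a * f x : ℝ≥0) : ℝ)) = (a : ℝ) * J _
        simpa using hsmul a _ a.2 (key f) }
  have hint : ∀ f, InC00plus f → ∫ x, f x ∂(NNRealRMK.rieszMeasure Λ) = J f := by
    intro f hf
    let F : C_c(G, ℝ≥0) :=
      { toFun := fun x => ⟨f x, hf.2.2 x⟩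
        continuous_toFun := hf.1.subtype_mk _
        hasCompactSupport' := by
          have : (fun x => (⟨f x, hf.2.2 x⟩ : ℝ≥0)) = fun x => (f x).toNNReal := by
            ext x; simp [hf.2.2 x]
          rw [this]
          exact hf.2.1.comp_left (g := Real.toNNReal) (by simp) }
    exact NNRealRMK.integral_rieszMeasure Λ F
  refine ⟨NNRealRMK.rieszMeasure Λ, inferInstance, hint, fun b => ?_⟩
  have : (Measure.map (L b) (NNRealRMK.rieszMeasure Λ)).Regular := Regular.map (L b)
  refine Measure.ext_of_integral_eq_on_compactlySupported_nnreal fun f => ?_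
  have e : ∫ x, (f x : ℝ) ∂(Measure.map (L b) (NNRealRMK.rieszMeasure Λ))
      = ∫ x, (f (L b x) : ℝ) ∂(NNRealRMK.rieszMeasure Λ) :=
    integral_map (L b).continuous.aemeasurable
      (Continuous.aestronglyMeasurable (key f).1)
  rw [e, hint _ (key f)]
  have hc : InC00plus (fun x => (f (L b x) : ℝ)) :=
    ⟨(key f).1.comp (L b).continuous, (key f).2.1.comp_homeomorph (L b), fun x => (key f).2.2 _⟩
  rw [hint _ hc]
  exact hinv b _ (key f)

theorem FLaux.exists_desc {G Q K : Type*} [TopologicalSpace G]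
    [Group Q] [TopologicalSpace Q] [IsTopologicalGroup Q]
    [Group K] [TopologicalSpace K] [IsTopologicalGroup K] [CompactSpace K]
    [MulAction K G] [ContinuousSMul K G]
    [MeasurableSpace K] [BorelSpace K]
    (π : G → Q) (hq : IsQuotientMap π)
    (horb : ∀ x y, π x = π y → ∃ k : K, k • x = y)
    (hπk : ∀ (k : K) x, π (k • x) = π x)
    (m : Measure K) [IsFiniteMeasureOnCompacts m] [m.IsMulLeftInvariant]
    (f : G → ℝ) (hf : InC00plus f) :
    ∃ F : Q → ℝ, Continuous F ∧ HasCompactSupport F ∧ ∀ x, F (π x) = ∫ k, f (k⁻¹ • x) ∂m := by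
  have hcont : Continuous (fun x => ∫ k : K, f (k⁻¹ • x) ∂m) := by
    rw [← continuousOn_univ]
    refine continuousOn_integral_of_compact_support (k := Set.univ) isCompact_univ ?_ (by simp)
    apply Continuous.continuousOn
    exact hf.1.comp (continuous_snd.inv.smul continuous_fst)
  have hinv : ∀ (k' : K) x, ∫ k : K, f (k⁻¹ • (k' • x)) ∂m = ∫ k : K, f (k⁻¹ • x) ∂m := by
    intro k' x
    rw [← integral_mul_left_eq_self (fun k : K => f (k⁻¹ • x)) k'⁻¹]
    congr 1 with k
    simp [mul_smul]
  obtain ⟨s, hs⟩ := hq.surjective.hasRightInverse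
  have hF : ∀ x, ∫ k : K, f (k⁻¹ • (s (π x))) ∂m = ∫ k : K, f (k⁻¹ • x) ∂m := by
    intro x
    obtain ⟨k', hk'⟩ := horb x (s (π x)) (hs (π x)).symm
    rw [← hk', hinv]
  refine ⟨fun q => ∫ k : K, f (k⁻¹ • (s q)) ∂m, ?_, ?_, hF⟩
  · rw [hq.continuous_iff]
    convert hcont using 1
    ext x
    exact hF x
  · refine HasCompactSupport.intro (hf.2.1.isCompact.image hq.continuous) ?_
    intro q hqn
    have : ∀ k : K, f (k⁻¹ • s q) = 0 := by
      intro k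
      by_contra hne
      exact hqn ⟨k⁻¹ • s q, subset_tsupport _ hne, by rw [hπk, hs]⟩
    simp [this]

theorem FLaux.one {G Q K : Type*} [TopologicalSpace G] [T2Space G] [LocallyCompactSpace G]
    [MeasurableSpace G] [BorelSpace G]
    [Group Q] [TopologicalSpace Q] [IsTopologicalGroup Q]
    [MeasurableSpace Q] [BorelSpace Q]
    [Group K] [TopologicalSpace K] [IsTopologicalGroup K] [CompactSpace K]
    [MulAction K G] [ContinuousSMul K G]
    [MeasurableSpace K] [BorelSpace K]
    (π : G → Q) (hq : IsQuotientMap π) (hπp : IsProperMap π)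
    (m : Measure K) [IsProbabilityMeasure m] (h : Measure Q) [IsHaarMeasure h]
    (L : G → G ≃ₜ G) (hπL : ∀ b x, π (L b x) = π b * π x)
    (hLK : ∀ k : K, ∃ b, ∀ x, L b x = k • x)
    (J : (G → ℝ) → ℝ)
    (h0 : ∀ f : G → ℝ, InC00plus f → 0 ≤ J f)
    (hadd : ∀ f g : G → ℝ, InC00plus f → InC00plus g → J (fun x => f x + g x) = J f + J g)
    (hsmul : ∀ (a : ℝ) (f : G → ℝ), 0 ≤ a → InC00plus f → J (fun x => a * f x) = a * J f)
    (hinv : ∀ (b : G) (f : G → ℝ), InC00plus f → J (fun x => f (L b x)) = J f) :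
    ∃ c : ℝ≥0, ∀ (f : G → ℝ) (F : Q → ℝ), InC00plus f → Continuous F → HasCompactSupport F →
      (∀ x, F (π x) = ∫ k, f ((k⁻¹ : K) • x) ∂m) → J f = c * ∫ q, F q ∂h := by
  obtain ⟨μ, hreg, hint, hmap⟩ := FLaux.exists_measure J h0 hadd hsmul L hinv
  have hfin : IsFiniteMeasureOnCompacts (μ.map π) := by
    constructor
    intro C hC
    refine (measure_mono subset_closure).trans_lt ?_
    rw [Measure.map_apply hq.continuous.measurable isClosed_closure.measurableSet]
    exact (hπp.isCompact_preimage hC.closure).measure_lt_top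
  have hinvQ : (μ.map π).IsMulLeftInvariant := by
    constructor
    intro q
    obtain ⟨b, rfl⟩ := hq.surjective q
    rw [Measure.map_map (measurable_const_mul _) hq.continuous.measurable]
    conv_rhs => rw [← hmap b]
    rw [Measure.map_map hq.continuous.measurable (L b).continuous.measurable]
    congr 1
    ext x
    simp [hπL]
  obtain ⟨c, hc⟩ := exists_integral_isMulLeftInvariant_eq_smul_of_hasCompactSupport (μ.map π) h
  refine ⟨c, fun f F hf hF hFc hFe => ?_⟩
  have h1 := hc F hF hFc
  rw [integral_smul_nnreal_measure, integral_map hq.continuous.aemeasurable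
    hF.aestronglyMeasurable] at h1
  simp only [hFe] at h1
  have h2 : ∫ x, ∫ k, f ((k⁻¹ : K) • x) ∂m ∂μ = ∫ k, ∫ x, f ((k⁻¹ : K) • x) ∂μ ∂m := by
    apply integral_integral_swap_of_hasCompactSupport
    · exact hf.1.comp (continuous_snd.inv.smul continuous_fst)
    · have hcpt : IsCompact ((fun z : G × K => (z.2 • z.1, z.2)) '' (tsupport f ×ˢ Set.univ)) :=
        (hf.2.1.isCompact.prod isCompact_univ).image
          ((continuous_snd.smul continuous_fst).prodMk continuous_snd)
      refine HasCompactSupport.intro hcpt ?_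
      rintro ⟨x, k⟩ hx
      by_contra hne
      exact hx ⟨(k⁻¹ • x, k), ⟨subset_tsupport _ hne, trivial⟩, by simp⟩
  have h3 : ∀ k : K, ∫ x, f ((k⁻¹ : K) • x) ∂μ = J f := by
    intro k
    obtain ⟨b, hb⟩ := hLK k⁻¹
    simp only [← hb]
    rw [hint (fun x => f (L b x)) ⟨hf.1.comp (L b).continuous, hf.2.1.comp_homeomorph (L b),
      fun x => hf.2.2 _⟩]
    exact hinv b f hf
  simp only [h3] at h2
  rw [h2] at h1
  simpa [NNReal.smul_def] using h1

theorem FLaux.main {G Q K : Type*} [TopologicalSpace G] [T2Space G] [LocallyCompactSpace G]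
    [Nonempty G]
    [Group Q] [TopologicalSpace Q] [IsTopologicalGroup Q]
    [Group K] [TopologicalSpace K] [IsTopologicalGroup K] [CompactSpace K]
    [MulAction K G] [ContinuousSMul K G]
    (π : G → Q) (hπo : IsOpenMap π) (hq : IsQuotientMap π) (hπp : IsProperMap π)
    (horb : ∀ x y, π x = π y → ∃ k : K, k • x = y)
    (hπk : ∀ (k : K) x, π (k • x) = π x)
    (L : G → G ≃ₜ G) (hπL : ∀ b x, π (L b x) = π b * π x)
    (hLK : ∀ k : K, ∃ b, ∀ x, L b x = k • x)
    (J H : (G → ℝ) → ℝ)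
    (h0 : ∀ f : G → ℝ, InC00plus f → 0 ≤ J f)
    (hpos : ∀ f : G → ℝ, InC00plus f → f ≠ 0 → 0 < J f)
    (hadd : ∀ f g : G → ℝ, InC00plus f → InC00plus g → J (fun x => f x + g x) = J f + J g)
    (hsmul : ∀ (a : ℝ) (f : G → ℝ), 0 ≤ a → InC00plus f → J (fun x => a * f x) = a * J f)
    (hinv : ∀ (b : G) (f : G → ℝ), InC00plus f → J (fun x => f (L b x)) = J f)
    (h0' : ∀ f : G → ℝ, InC00plus f → 0 ≤ H f)
    (hpos' : ∀ f : G → ℝ, InC00plus f → f ≠ 0 → 0 < H f)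
    (hadd' : ∀ f g : G → ℝ, InC00plus f → InC00plus g → H (fun x => f x + g x) = H f + H g)
    (hsmul' : ∀ (a : ℝ) (f : G → ℝ), 0 ≤ a → InC00plus f → H (fun x => a * f x) = a * H f)
    (hinv' : ∀ (b : G) (f : G → ℝ), InC00plus f → H (fun x => f (L b x)) = H f) :
    ∃ κ : ℝ, 0 < κ ∧ ∀ f : G → ℝ, InC00plus f → H f = κ * J f := by
  let _ : MeasurableSpace G := borel G
  have : BorelSpace G := ⟨rfl⟩
  let _ : MeasurableSpace Q := borel Q
  have : BorelSpace Q := ⟨rfl⟩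
  let _ : MeasurableSpace K := borel K
  have : BorelSpace K := ⟨rfl⟩
  have : LocallyCompactSpace Q := by
    obtain ⟨x⟩ := ‹Nonempty G›
    obtain ⟨C, hC, hCx⟩ := exists_compact_mem_nhds x
    exact ((hC.image hq.continuous).locallyCompactSpace_of_mem_nhds_of_group
      (x := π x) (hπo.image_mem_nhds hCx))
  let m : Measure K := haarMeasure (⊤ : TopologicalSpace.PositiveCompacts K)
  have : IsProbabilityMeasure m := ⟨by
    simpa using haarMeasure_self (K₀ := (⊤ : TopologicalSpace.PositiveCompacts K))⟩
  let h : Measure Q := Measure.haar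
  obtain ⟨c, hc⟩ := FLaux.one π hq hπp m h L hπL hLK J h0 hadd hsmul hinv
  obtain ⟨d, hd⟩ := FLaux.one π hq hπp m h L hπL hLK H h0' hadd' hsmul' hinv'
  have hex : ∃ f : G → ℝ, InC00plus f ∧ f ≠ 0 := by
    obtain ⟨x⟩ := ‹Nonempty G›
    obtain ⟨f, hf1, hf2, hf3⟩ := exists_continuous_nonneg_pos x
    exact ⟨f, ⟨f.continuous, hf1, hf2⟩, fun h => hf3 (by rw [h]; rfl)⟩
  obtain ⟨f₀, hf₀, hne⟩ := hex
  obtain ⟨F₀, a1, a2, a3⟩ := FLaux.exists_desc π hq horb hπk m f₀ hf₀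
  have e1 := hpos f₀ hf₀ hne
  have e2 := hpos' f₀ hf₀ hne
  rw [hc f₀ F₀ hf₀ a1 a2 a3] at e1
  rw [hd f₀ F₀ hf₀ a1 a2 a3] at e2
  have c0 : (0:ℝ) < c := lt_of_le_of_ne c.2 (fun h => by
    have : (c:ℝ) = 0 := h.symm
    rw [this] at e1; simp at e1)
  have d0 : (0:ℝ) < d := lt_of_le_of_ne d.2 (fun h => by
    have : (d:ℝ) = 0 := h.symm
    rw [this] at e2; simp at e2)
  refine ⟨d / c, div_pos d0 c0, fun f hf => ?_⟩
  obtain ⟨F, b1, b2, b3⟩ := FLaux.exists_desc π hq horb hπk m f hf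
  rw [hc f F hf b1 b2 b3, hd f F hf b1 b2 b3]
  field_simp

namespace FLaux
variable {G : Type*} [FanLoop G]

theorem lcancel {a x y : G} (h : a * x = a * y) : x = y :=
  (FanLoop.ldiv_unique a x _ h).trans (FanLoop.ldiv_unique a y _ rfl).symm

theorem rcancel {a x y : G} (h : x * a = y * a) : x = y :=
  (FanLoop.rdiv_unique a x _ h).trans (FanLoop.rdiv_unique a y _ rfl).symm

/-- normal subgroups of the nucleus containing all associators -/
structure Good (K : Set G) : Prop where
  nuc : K ⊆ nucleus G
  one : (1 : G) ∈ K
  mul : ∀ x ∈ K, ∀ y ∈ K, x * y ∈ K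
  inv : ∀ x ∈ K, ldiv x 1 ∈ K
  tmem : ∀ a b c : G, t a b c ∈ K
  conjL : ∀ (a : G), ∀ k ∈ K, ∃ k' ∈ K, a * k = k' * a
  conjR : ∀ (a : G), ∀ k ∈ K, ∃ k' ∈ K, k * a = a * k'

theorem nucL {n : G} (h : n ∈ nucleus G) (b c : G) : (n * b) * c = n * (b * c) := h.1 b c
theorem nucM {n : G} (h : n ∈ nucleus G) (b c : G) : (b * n) * c = b * (n * c) := h.2.1 b c
theorem nucR {n : G} (h : n ∈ nucleus G) (b c : G) : (b * c) * n = b * (c * n) := h.2.2 b c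

theorem inv_mul_nuc {n : G} (h : n ∈ nucleus G) : ldiv n 1 * n = 1 := by
  apply lcancel (a := n)
  rw [← nucL h, FanLoop.mul_ldiv, FanLoop.one_mul, FanLoop.mul_one]

/-- the normal core -/
def core (N₀ : Set G) : Set G := {n | ∀ a : G, rdiv (a * n) a ∈ N₀}

theorem mem_core {N₀ : Set G} {n : G} : n ∈ core N₀ ↔ ∀ a : G, ∃ m ∈ N₀, a * n = m * a := by
  constructor
  · intro h a
    exact ⟨_, h a, (FanLoop.rdiv_mul a (a * n)).symm⟩
  · intro h a
    obtain ⟨m, hm, e⟩ := h a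
    rw [← FanLoop.rdiv_unique a m _ e.symm]
    exact hm

theorem good_core (N₀ : Set G) (hsub : N₀ ⊆ nucleus G) (h1 : (1 : G) ∈ N₀)
    (hmulc : ∀ x ∈ N₀, ∀ y ∈ N₀, x * y ∈ N₀) (hinvc : ∀ x ∈ N₀, ldiv x 1 ∈ N₀)
    (ht : ∀ a b c : G, t a b c ∈ N₀) : Good (core N₀) := by
  have hsubN : core N₀ ⊆ N₀ := by
    intro n hn
    obtain ⟨m, hm, e⟩ := mem_core.1 hn 1
    rw [FanLoop.one_mul, FanLoop.mul_one] at e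
    rwa [e]
  have hmul : ∀ x ∈ core N₀, ∀ y ∈ core N₀, x * y ∈ core N₀ := by
    intro x hx y hy
    rw [mem_core]
    intro a
    obtain ⟨m, hm, e⟩ := mem_core.1 hx a
    obtain ⟨m', hm', e'⟩ := mem_core.1 hy a
    refine ⟨m * m', hmulc _ hm _ hm', ?_⟩
    rw [← nucR (hsub (hsubN hy)), e, nucL (hsub hm), e', nucL (hsub hm)]
  have htm : ∀ a b c : G, t a b c ∈ core N₀ := by
    intro b c d
    rw [mem_core]
    intro a
    have nt := fun a b c : G => hsub (ht a b c)
    have E1 : ((a * b) * c) * d = (t (a * b) c d * t a b (c * d)) * (a * (b * (c * d))) := by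
      rw [FanLoop.t_spec (a * b) c d, FanLoop.t_spec a b (c * d), nucL (nt _ _ _)]
    have E2 : ((a * b) * c) * d
        = (t a b c * t a (b * c) d) * ((a * t b c d) * (b * (c * d))) := by
      rw [FanLoop.t_spec a b c, nucL (nt a b c), FanLoop.t_spec a (b * c) d,
        FanLoop.t_spec b c d, nucL (nt a b c), nucM (nt b c d)]
    set u := t a b c * t a (b * c) d with hu
    set v := t (a * b) c d * t a b (c * d) with hv
    have huN : u ∈ N₀ := hmulc _ (ht _ _ _) _ (ht _ _ _)
    have hvN : v ∈ N₀ := hmulc _ (ht _ _ _) _ (ht _ _ _)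
    have huI := hinvc u huN
    refine ⟨ldiv u 1 * v, hmulc _ huI _ hvN, ?_⟩
    apply rcancel (a := b * (c * d))
    apply lcancel (a := u)
    rw [← E2, E1, nucL (hsub (hmulc _ huI _ hvN)), ← nucL (hsub huN), ← nucL (hsub huN) (ldiv u 1),
      FanLoop.mul_ldiv, FanLoop.one_mul]
  have hcL : ∀ (a : G), ∀ k ∈ core N₀, ∃ k' ∈ core N₀, a * k = k' * a := by
    intro a k hk
    obtain ⟨m, hm, e⟩ := mem_core.1 hk a
    refine ⟨m, ?_, e⟩
    rw [mem_core]
    intro b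
    obtain ⟨m', hm', e'⟩ := mem_core.1 hk (b * a)
    refine ⟨m', hm', ?_⟩
    apply rcancel (a := a)
    rw [nucM (hsub hm), ← e, ← nucR (hsub (hsubN hk)), e', nucL (hsub hm')]
  refine ⟨hsubN.trans hsub, ?_, hmul, ?_, htm, hcL, ?_⟩
  · rw [mem_core]
    intro a
    exact ⟨1, h1, by rw [FanLoop.one_mul, FanLoop.mul_one]⟩
  · intro x hx
    rw [mem_core]
    intro a
    have hxN := hsub (hsubN hx)
    obtain ⟨m, hm, e⟩ := mem_core.1 hx a
    refine ⟨ldiv m 1, hinvc _ hm, ?_⟩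
    apply rcancel (a := x)
    rw [nucR hxN, inv_mul_nuc hxN, FanLoop.mul_one, nucL (hsub (hinvc _ hm)), e,
      ← nucL (hsub (hinvc _ hm)), inv_mul_nuc (hsub hm), FanLoop.one_mul]
  · intro a k hk
    have hs : k * a = a * ldiv a (k * a) := (FanLoop.mul_ldiv _ _).symm
    set s := ldiv a (k * a)
    refine ⟨s, ?_, hs⟩
    obtain ⟨k', hk', e⟩ := hcL (rdiv 1 a) k hk
    have hkN := hsub (hsubN hk)
    have hk'N := hsub (hsubN hk')
    have A1 : rdiv 1 a * (k * a) = k' := by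
      rw [← nucM hkN, e, nucL hk'N, FanLoop.rdiv_mul, FanLoop.mul_one]
    have A2 := FanLoop.t_spec (rdiv 1 a) a s
    rw [← hs, A1, FanLoop.rdiv_mul, FanLoop.one_mul] at A2
    rw [A2]
    exact hmul _ (htm _ _ _) _ hk'

/-- group structure on `K` -/
abbrev groupK {K : Set G} (hK : Good K) : Group K :=
  { mul := fun x y => ⟨x.1 * y.1, hK.mul _ x.2 _ y.2⟩
    one := ⟨1, hK.one⟩
    inv := fun x => ⟨ldiv x.1 1, hK.inv _ x.2⟩
    mul_assoc := fun x y z => Subtype.ext (nucL (hK.nuc x.2) y.1 z.1)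
    one_mul := fun x => Subtype.ext (FanLoop.one_mul x.1)
    mul_one := fun x => Subtype.ext (FanLoop.mul_one x.1)
    inv_mul_cancel := fun x => Subtype.ext (inv_mul_nuc (hK.nuc x.2)) }

/-- action of `K` on `G` -/
abbrev actK {K : Set G} (hK : Good K) : @MulAction K G (groupK hK).toMonoid :=
  letI := groupK hK
  { smul := fun k x => k.1 * x
    one_smul := fun x => FanLoop.one_mul x
    mul_smul := fun k l x => nucL (hK.nuc k.2) l.1 x }

/-- cosets -/
def cosetK {K : Set G} (hK : Good K) : Setoid G where
  r x y := ∃ k ∈ K, k * x = y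
  iseqv :=
    { refl := fun x => ⟨1, hK.one, FanLoop.one_mul x⟩
      symm := by
        rintro x y ⟨k, hk, rfl⟩
        refine ⟨ldiv k 1, hK.inv k hk, ?_⟩
        rw [← nucL (hK.nuc (hK.inv k hk)), inv_mul_nuc (hK.nuc hk), FanLoop.one_mul]
      trans := by
        rintro x y z ⟨k, hk, rfl⟩ ⟨l, hl, rfl⟩
        exact ⟨l * k, hK.mul _ hl _ hk, nucL (hK.nuc hl) _ _⟩ }

theorem coset_mul {K : Set G} (hK : Good K) {a b x y : G} (h : (cosetK hK).r a b)
    (h' : (cosetK hK).r x y) : (cosetK hK).r (a * x) (b * y) := by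
  obtain ⟨k, hk, rfl⟩ := h
  obtain ⟨l, hl, rfl⟩ := h'
  obtain ⟨l', hl', e⟩ := hK.conjL a l hl
  refine ⟨k * l', hK.mul _ hk _ hl', ?_⟩
  rw [nucL (hK.nuc hk), nucL (hK.nuc hk), ← nucL (hK.nuc hl'), ← e, nucM (hK.nuc hl)]

theorem coset_inv {K : Set G} (hK : Good K) {a b : G} (h : (cosetK hK).r a b) :
    (cosetK hK).r (rdiv 1 a) (rdiv 1 b) := by
  have h := (cosetK hK).iseqv.symm h
  obtain ⟨k, hk, rfl⟩ := h
  obtain ⟨l, hl, e⟩ := hK.conjL (rdiv 1 (k * b)) k hk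
  refine ⟨l, hl, ?_⟩
  rw [← e]
  apply FanLoop.rdiv_unique
  rw [nucM (hK.nuc hk), FanLoop.rdiv_mul]

/-- quotient group -/
abbrev groupQ {K : Set G} (hK : Good K) : Group (Quotient (cosetK hK)) :=
  { mul := Quotient.map₂ (· * ·) (fun _ _ h _ _ h' => coset_mul hK h h')
    one := Quotient.mk _ 1
    inv := Quotient.map (fun a => rdiv 1 a) (fun _ _ h => coset_inv hK h)
    mul_assoc := by
      rintro ⟨a⟩ ⟨b⟩ ⟨c⟩
      exact Quotient.sound ((cosetK hK).iseqv.symm ⟨t a b c, hK.tmem a b c, (FanLoop.t_spec a b c).symm⟩)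
    one_mul := by
      rintro ⟨a⟩
      exact congrArg (Quotient.mk _) (FanLoop.one_mul a)
    mul_one := by
      rintro ⟨a⟩
      exact congrArg (Quotient.mk _) (FanLoop.mul_one a)
    inv_mul_cancel := by
      rintro ⟨a⟩
      exact congrArg (Quotient.mk _) (FanLoop.rdiv_mul a 1) }

end FLaux

end FLauxSection

/-- Theorem 3.20 of Ludkowski: uniqueness up to a positive constant of nontrivial
nonnegative linear left invariant functionals on C₀₀⁺(G). -/
theorem fanLoop_left_invariant_functional_unique {G : Type*} [TopologicalSpace G]
    [T1Space G] [LocallyCompactSpace G] [FanLoop G]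
    (hm : Continuous fun q : G × G => q.1 * q.2)
    (hl : Continuous fun q : G × G => ldiv q.1 q.2)
    (hr : Continuous fun q : G × G => rdiv q.1 q.2)
    -- Condition (3.5.2): a compact subgroup N₀ of the nucleus containing all t, p values
    (N₀ : Set G) (hcpt : IsCompact N₀) (hsub : N₀ ⊆ nucleus G) (h1 : (1 : G) ∈ N₀)
    (hmulc : ∀ x ∈ N₀, ∀ y ∈ N₀, x * y ∈ N₀) (hinvc : ∀ x ∈ N₀, ldiv x 1 ∈ N₀)
    (ht : ∀ a b c : G, t a b c ∈ N₀) (hp : ∀ a b c : G, p a b c ∈ N₀)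
    (J H : (G → ℝ) → ℝ)
    (hJ0 : ∀ f : G → ℝ, InC00plus f → 0 ≤ J f)
    (hJpos : ∀ f : G → ℝ, InC00plus f → f ≠ 0 → 0 < J f)
    (hJlin : ∀ (n : ℕ) (f : Fin n → G → ℝ) (α : Fin n → ℝ),
      (∀ i, InC00plus (f i)) → (∀ i, 0 ≤ α i) →
      J (fun x => ∑ i, α i * f i x) = ∑ i, α i * J (f i))
    (hJinv : ∀ (b : G) (f : G → ℝ), InC00plus f → J (fun x => f (b * x)) = J f)
    (hH0 : ∀ f : G → ℝ, InC00plus f → 0 ≤ H f)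
    (hHpos : ∀ f : G → ℝ, InC00plus f → f ≠ 0 → 0 < H f)
    (hHlin : ∀ (n : ℕ) (f : Fin n → G → ℝ) (α : Fin n → ℝ),
      (∀ i, InC00plus (f i)) → (∀ i, 0 ≤ α i) →
      H (fun x => ∑ i, α i * f i x) = ∑ i, α i * H (f i))
    (hHinv : ∀ (b : G) (f : G → ℝ), InC00plus f → H (fun x => f (b * x)) = H f) :
    ∃ κ : ℝ, 0 < κ ∧ ∀ f : G → ℝ, InC00plus f → H f = κ * J f := by
  have : T2Space G := by
    rw [t2_iff_isClosed_diagonal]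
    have : Set.diagonal G = (fun q : G × G => ldiv q.1 q.2) ⁻¹' {1} := by
      ext ⟨x, y⟩
      simp only [Set.mem_diagonal_iff, Set.mem_preimage, Set.mem_singleton_iff]
      constructor
      · rintro rfl
        exact (FanLoop.ldiv_unique _ _ _ (FanLoop.mul_one x)).symm
      · intro h
        have := FanLoop.mul_ldiv x y
        rwa [h, FanLoop.mul_one] at this
    rw [this]
    exact isClosed_singleton.preimage hl
  have hK := FLaux.good_core N₀ hsub h1 hmulc hinvc ht
  have hKc : IsCompact (FLaux.core N₀) := by
    have hcl : IsClosed (FLaux.core N₀) := by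
      have : FLaux.core N₀ = ⋂ a : G, (fun n => rdiv (a * n) a) ⁻¹' N₀ := by
        ext n; simp [FLaux.core]
      rw [this]
      refine isClosed_iInter fun a => hcpt.isClosed.preimage ?_
      exact hr.comp ((hm.comp (continuous_const.prodMk continuous_id)).prodMk continuous_const)
    refine hcpt.of_isClosed_subset hcl fun n hn => ?_
    obtain ⟨m, hm, e⟩ := FLaux.mem_core.1 hn 1
    rw [FanLoop.one_mul, FanLoop.mul_one] at e
    rwa [e]
  generalize FLaux.core N₀ = K at hK hKc
  let _ : Group K := FLaux.groupK hK
  let _ : MulAction K G := FLaux.actK hK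
  have : CompactSpace K := isCompact_iff_compactSpace.1 hKc
  have : IsTopologicalGroup K :=
    { continuous_mul := Continuous.subtype_mk (hm.comp
        ((continuous_subtype_val.comp continuous_fst).prodMk
          (continuous_subtype_val.comp continuous_snd))) _
      continuous_inv := Continuous.subtype_mk (hl.comp
        (continuous_subtype_val.prodMk continuous_const)) _ }
  have : ContinuousSMul K G :=
    ⟨hm.comp ((continuous_subtype_val.comp continuous_fst).prodMk continuous_snd)⟩
  let L : G → G ≃ₜ G := fun b =>
    { toFun := fun x => b * x
      invFun := fun x => ldiv b x
      left_inv := fun x => (FanLoop.ldiv_unique b x _ rfl).symm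
      right_inv := fun x => FanLoop.mul_ldiv b x
      continuous_toFun := hm.comp (continuous_const.prodMk continuous_id)
      continuous_invFun := hl.comp (continuous_const.prodMk continuous_id) }
  let Q := Quotient (FLaux.cosetK hK)
  let _ : Group Q := FLaux.groupQ hK
  let π : G → Q := Quotient.mk _
  have hq : Topology.IsQuotientMap π := isQuotientMap_quot_mk
  have hπk : ∀ (k : K) x, π (k • x) = π x := fun k x =>
    (Quotient.sound (⟨k.1, k.2, rfl⟩ : (FLaux.cosetK hK).r x (k • x))).symm
  have horb : ∀ x y, π x = π y → ∃ k : K, k • x = y := by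
    intro x y h
    obtain ⟨k, hk, e⟩ : (FLaux.cosetK hK).r x y := Quotient.exact h
    exact ⟨⟨k, hk⟩, e⟩
  have hsat : ∀ s : Set G, π ⁻¹' (π '' s) = ⋃ k : K, (k • ·) '' s := by
    intro s
    ext y
    simp only [Set.mem_preimage, Set.mem_image, Set.mem_iUnion]
    constructor
    · rintro ⟨x, hx, e⟩
      obtain ⟨k, rfl⟩ := horb x y e
      exact ⟨k, x, hx, rfl⟩
    · rintro ⟨k, x, hx, rfl⟩
      exact ⟨x, hx, (hπk k x).symm⟩
  have hπo : IsOpenMap π := by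
    intro s hs
    rw [← hq.isOpen_preimage, hsat]
    exact isOpen_iUnion fun k => (Homeomorph.smul k).isOpenMap s hs
  have hπp : IsProperMap π := by
    rw [isProperMap_iff_isClosedMap_and_compact_fibers]
    refine ⟨hq.continuous, ?_, ?_⟩
    · intro s hs
      rw [← hq.isClosed_preimage, hsat]
      have : (⋃ k : K, (k • ·) '' s) = Prod.snd '' ((fun z : K × G => z.1⁻¹ • z.2) ⁻¹' s) := by
        ext y
        simp only [Set.mem_iUnion, Set.mem_image, Set.mem_preimage, Prod.exists, exists_eq_right]
        refine exists_congr fun k => ?_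
        constructor
        · rintro ⟨x, hx, rfl⟩
          simpa using hx
        · intro h
          exact ⟨_, h, by simp⟩
      rw [this]
      exact isClosedMap_snd_of_compactSpace _
        (hs.preimage (continuous_fst.inv.smul continuous_snd))
    · intro q
      obtain ⟨x, rfl⟩ := hq.surjective q
      have : π ⁻¹' {π x} = (fun k : K => k • x) '' Set.univ := by
        rw [← Set.image_singleton, hsat]
        ext y
        simp
      rw [this]
      exact isCompact_univ.image (continuous_id.smul continuous_const)
  have : IsTopologicalGroup Q :=
    { continuous_mul := by
        have h2 : Topology.IsQuotientMap (Prod.map π π) :=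
          (hπo.prodMap hπo).isQuotientMap (hq.continuous.prodMap hq.continuous)
            (hq.surjective.prodMap hq.surjective)
        rw [h2.continuous_iff]
        exact hq.continuous.comp hm
      continuous_inv := by
        rw [hq.continuous_iff]
        exact hq.continuous.comp (hr.comp (continuous_const.prodMk continuous_id)) }
  have lin : ∀ J : (G → ℝ) → ℝ, (∀ (n : ℕ) (f : Fin n → G → ℝ) (α : Fin n → ℝ),
      (∀ i, InC00plus (f i)) → (∀ i, 0 ≤ α i) →
      J (fun x => ∑ i, α i * f i x) = ∑ i, α i * J (f i)) →
      (∀ f g : G → ℝ, InC00plus f → InC00plus g → J (fun x => f x + g x) = J f + J g) ∧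
      (∀ (a : ℝ) (f : G → ℝ), 0 ≤ a → InC00plus f → J (fun x => a * f x) = a * J f) := by
    intro J h
    constructor
    · intro f g hf hg
      have := h 2 ![f, g] ![1, 1] (by simp [Fin.forall_fin_two, hf, hg])
        (by simp [Fin.forall_fin_two])
      simpa using this
    · intro a f ha hf
      have := h 1 ![f] ![a] (by simp [hf]) (by simp [ha])
      simpa using this
  have : Nonempty G := ⟨1⟩
  exact FLaux.main π hπo hq hπp horb hπk L (fun b x => rfl) (fun k => ⟨k.1, fun x => rfl⟩) J H
    hJ0 hJpos (lin J hJlin).1 (lin J hJlin).2 hJinv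
    hH0 hHpos (lin H hHlin).1 (lin H hHlin).2 hHinv
end
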